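/- arXiv:1506.01202 — 7 statements merged into one kernel-verified Lean document; each statement's English description precedes it below -/
import Mathlib

section
/- For every even rational parameter p/q, the plaid model is coherent: every integer unit square in the plane contains either 0 or 2 good edges. -/
noncomputable section
open scoped Classical

/-- The representative of `x` modulo `2ℤ` lying in `[-1,1)`.  For the values arising in the
plaid model (which are never congruent to an odd integer modulo `2ℤ`) this is the unique
representative in `(-1,1)`. -/
def nrm (x : ℝ) : ℝ := x - 2 * ⌊(x + 1) / 2⌋

/-- An even rational parameter `p/q`: coprime positive integers `p < q` with `p*q` even. -/
structure Param where
  p : ℕ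
  q : ℕ
  p_pos : 0 < p
  p_lt_q : p < q
  coprime : Nat.Coprime p q
  even_pq : Even (p * q)

/-- `z` lies on a line of the family `𝓗` (horizontal lines with integer `y`-coordinate). -/
def onH (z : ℝ × ℝ) : Prop := ∃ n : ℤ, z.2 = (n : ℝ)

/-- `z` lies on a line of the family `𝓥` (vertical lines with integer `x`-coordinate). -/
def onV (z : ℝ × ℝ) : Prop := ∃ n : ℤ, z.1 = (n : ℝ)

/-- The lightness condition on the pair of values `(F_A(z), F_B(z))`:
`F_A(z)·F_B(z) > 0` and `|F_B(z)| < |F_A(z)|`. -/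
def lightPair (a b : ℝ) : Prop := a * b > 0 ∧ |b| < |a|

namespace Param

variable (π : Param)

def ω : ℕ := π.p + π.q

def P : ℝ := 2 * π.p / π.ω

def Q : ℝ := 2 * π.q / π.ω

/-- `z` lies on a line of `𝓟` (slope `-P`, integer `y`-intercept). -/
def onP (z : ℝ × ℝ) : Prop := ∃ n : ℤ, z.2 + π.P * z.1 = (n : ℝ)

/-- `z` lies on a line of `𝓠` (slope `-Q`, integer `y`-intercept). -/
def onQ (z : ℝ × ℝ) : Prop := ∃ n : ℤ, z.2 + π.Q * z.1 = (n : ℝ)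

def FH (z : ℝ × ℝ) : ℝ := nrm (2 * π.P * z.2)
def FV (z : ℝ × ℝ) : ℝ := nrm (2 * π.P * z.1)
def FP (z : ℝ × ℝ) : ℝ := nrm (π.P * z.2 + π.P ^ 2 * z.1 + 1)
def FQ (z : ℝ × ℝ) : ℝ := nrm (π.P * z.2 + π.P * π.Q * z.1 + 1)

/-- `z` is a light intersection point of type `P` on a horizontal (`𝓗`) line. -/
def lightHP (z : ℝ × ℝ) : Prop := onH z ∧ π.onP z ∧ lightPair (π.FH z) (π.FP z)

/-- `z` is a light intersection point of type `Q` on a horizontal (`𝓗`) line. -/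
def lightHQ (z : ℝ × ℝ) : Prop := onH z ∧ π.onQ z ∧ lightPair (π.FH z) (π.FQ z)

/-- `z` is a light intersection point of type `P` on a vertical (`𝓥`) line. -/
def lightVP (z : ℝ × ℝ) : Prop := onV z ∧ π.onP z ∧ lightPair (π.FV z) (π.FP z)

/-- `z` is a light intersection point of type `Q` on a vertical (`𝓥`) line. -/
def lightVQ (z : ℝ × ℝ) : Prop := onV z ∧ π.onQ z ∧ lightPair (π.FV z) (π.FQ z)

/-- `z` is a light point (of some kind). -/
def light (z : ℝ × ℝ) : Prop := π.lightHP z ∨ π.lightHQ z ∨ π.lightVP z ∨ π.lightVQ z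

/-- The number of light points, with the double-counting convention (a light point which is the
midpoint of the segment, lying simultaneously on a `𝓟` line and a `𝓠` line, counts twice), on
the horizontal unit segment from `(m,n)` to `(m+1,n)`. -/
def hLightCount (m n : ℤ) : ℕ :=
  Set.ncard {x : ℝ | x ∈ Set.Icc (m : ℝ) ((m : ℝ) + 1) ∧ π.lightHP (x, (n : ℝ))} +
  Set.ncard {x : ℝ | x ∈ Set.Icc (m : ℝ) ((m : ℝ) + 1) ∧ π.lightHQ (x, (n : ℝ)) ∧
    (π.onP (x, (n : ℝ)) → x = (m : ℝ) + 1 / 2)}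

/-- The number of light points on the vertical unit segment from `(m,n)` to `(m,n+1)`. -/
def vLightCount (m n : ℤ) : ℕ :=
  Set.ncard {y : ℝ | y ∈ Set.Icc (n : ℝ) ((n : ℝ) + 1) ∧ π.lightVP ((m : ℝ), y)} +
  Set.ncard {y : ℝ | y ∈ Set.Icc (n : ℝ) ((n : ℝ) + 1) ∧ π.lightVQ ((m : ℝ), y)}

/-- The horizontal unit segment from `(m,n)` to `(m+1,n)` is good: it contains exactly one
light point (with the double-counting convention). -/
def goodH (m n : ℤ) : Prop := π.hLightCount m n = 1

/-- The vertical unit segment from `(m,n)` to `(m,n+1)` is good. -/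
def goodV (m n : ℤ) : Prop := π.vLightCount m n = 1

end Param


namespace PlaidAux

/-- Two integers whose difference lies in `[kD,(k+1)D)` have quotients by `D` differing by
`k` or `k+1`. -/
lemma step {D : ℤ} (hD : 0 < D) (k x y : ℤ) (h1 : k * D ≤ y - x) (h2 : y - x < (k + 1) * D) :
    y / D = x / D + k ∨ y / D = x / D + k + 1 := by
  have a1 := Int.mul_ediv_add_emod x D
  have a2 := Int.mul_ediv_add_emod y D
  have b1 := Int.emod_nonneg x hD.ne'
  have b2 := Int.emod_nonneg y hD.ne'
  have c1 := Int.emod_lt_of_pos x hD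
  have c2 := Int.emod_lt_of_pos y hD
  have u1 : x / D + k - 1 < y / D := by
    by_contra hc
    push Not at hc
    nlinarith
  have u2 : y / D < x / D + k + 2 := by
    by_contra hc
    push Not at hc
    nlinarith
  omega

lemma refl_div {D : ℤ} (hD : 0 < D) (x y : ℤ) (h : x + y = D) (hx : ¬ D ∣ x) :
    x / D = -(y / D) := by
  have a1 := Int.mul_ediv_add_emod x D
  have a2 := Int.mul_ediv_add_emod y D
  have b1 : 0 < x % D := (Int.emod_pos_of_not_dvd hx).resolve_left hD.ne'
  have b2 := Int.emod_nonneg y hD.ne'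
  have c1 := Int.emod_lt_of_pos x hD
  have c2 := Int.emod_lt_of_pos y hD
  have u1 : x / D + y / D < 1 := by
    by_contra hc
    push Not at hc
    nlinarith
  have u2 : -1 < x / D + y / D := by
    by_contra hc
    push Not at hc
    nlinarith
  omega

lemma not_dvd_odd {w x : ℤ} (h : Odd x) : ¬ (2 * w) ∣ x := by
  rintro ⟨c, hc⟩
  rw [hc] at h
  have : Even (2 * w * c) := ⟨w * c, by ring⟩
  exact (Int.not_odd_iff_even.mpr this) h

/-- Combinatorial version of lightness. -/
def LZ (p w j k : ℤ) : Prop :=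
  Odd ((2 * p * k + w) / (2 * w) + (2 * p * k + w - 4 * p * j) / (2 * w) +
    (4 * p * j + w) / (2 * w))

lemma xor_LZ (p w j k l : ℤ) : ¬ (LZ p w j k ↔ LZ p w j l) ↔
    ((2 * p * k + w) / (2 * w) + (2 * p * k + w - 4 * p * j) / (2 * w) +
    ((2 * p * l + w) / (2 * w) + (2 * p * l + w - 4 * p * j) / (2 * w))) % 2 = 1 := by
  unfold LZ
  simp only [Int.odd_iff]
  omega

/-- The combinatorial core, when no `𝓟`-line meets the horizontal edges. -/
lemma coreA (p w m n α : ℤ) (hp : 0 < p) (hw : Odd w) (hpw : 2 * p < w)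
    (hf0 : w * α ≤ 2 * p * m) (hf1 : 2 * p * m + 2 * p < w * α + w)
    (a b c d : Prop)
    (ha : a ↔ ¬ ((LZ p w n (n + 2 * m - α)) ↔ (LZ p w n (n + 2 * m - α + 1))))
    (hb : b ↔ ¬ ((LZ p w (n + 1) (n + 2 * m - α + 1)) ↔ (LZ p w (n + 1) (n + 2 * m - α + 2))))
    (hc : c ↔ ¬ ((LZ p w m (n + α + 1)) ↔ (LZ p w m (n + 2 * m - α))))
    (hd : d ↔ ¬ ((LZ p w (m + 1) (n + α + 1)) ↔ (LZ p w (m + 1) (n + 2 * m - α + 2)))) :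
    ((if a then 1 else 0) + (if b then 1 else 0) + (if c then 1 else 0) +
      (if d then 1 else 0) = 0) ∨
    ((if a then 1 else 0) + (if b then 1 else 0) + (if c then 1 else 0) +
      (if d then 1 else 0) = 2) := by
  rw [xor_LZ] at ha hb hc hd
  have hD : 0 < 2 * w := by linarith
  obtain ⟨b1, hb1⟩ : ∃ x, x = 2 * p * (n + α + 1) + w := ⟨_, rfl⟩
  obtain ⟨b2, hb2⟩ : ∃ x, x = 2 * p * (n + 2 * m - α) + w := ⟨_, rfl⟩
  rw [show 2 * p * (n + 2 * m - α) + w = b2 by rw [hb2],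
    show 2 * p * (n + 2 * m - α + 1) + w = b2 + 2 * p by rw [hb2]; ring,
    show b2 + 2 * p - 4 * p * n = b2 - 4 * p * n + 2 * p by ring] at ha
  rw [show 2 * p * (n + 2 * m - α + 1) + w = b2 + 2 * p by rw [hb2]; ring,
    show 2 * p * (n + 2 * m - α + 2) + w = b2 + 4 * p by rw [hb2]; ring,
    show b2 + 2 * p - 4 * p * (n + 1) = b2 - 4 * p * n - 2 * p by ring,
    show b2 + 4 * p - 4 * p * (n + 1) = b2 - 4 * p * n by ring] at hb
  rw [show 2 * p * (n + 2 * m - α) + w = b2 by rw [hb2],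
    show 2 * p * (n + α + 1) + w = b1 by rw [hb1]] at hc
  rw [show 2 * p * (n + 2 * m - α + 2) + w = b2 + 4 * p by rw [hb2]; ring,
    show 2 * p * (n + α + 1) + w = b1 by rw [hb1],
    show b1 - 4 * p * (m + 1) = b1 - 4 * p * m - 4 * p by ring,
    show b2 + 4 * p - 4 * p * (m + 1) = b2 - 4 * p * m by ring] at hd
  have r1 := refl_div hD (b1 - 4 * p * m) (b2 - 4 * p * n - 2 * p) (by rw [hb1, hb2]; ring)
    (not_dvd_odd (by
      rw [hb1, show 2 * p * (n + α + 1) + w - 4 * p * m = w + 2 * (p * (n + α + 1) - 2 * p * m) by ring]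
      exact hw.add_even ⟨p * (n + α + 1) - 2 * p * m, by ring⟩))
  have r2 := refl_div hD (b1 - 4 * p * m - 4 * p) (b2 - 4 * p * n + 2 * p) (by rw [hb1, hb2]; ring)
    (not_dvd_odd (by
      rw [hb1, show 2 * p * (n + α + 1) + w - 4 * p * m - 4 * p
        = w + 2 * (p * (n + α + 1) - 2 * p * m - 2 * p) by ring]
      exact hw.add_even ⟨p * (n + α + 1) - 2 * p * m - 2 * p, by ring⟩))
  have s1 := step hD 0 b2 (b2 + 2 * p) (by linarith) (by linarith)
  have s2 := step hD 0 (b2 + 2 * p) (b2 + 4 * p) (by linarith) (by linarith)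
  have s3 := step hD 0 b2 (b2 + 4 * p) (by linarith) (by linarith)
  have s4 := step hD 0 (b2 - 4 * p * n - 2 * p) (b2 - 4 * p * n) (by linarith) (by linarith)
  have s5 := step hD 0 (b2 - 4 * p * n) (b2 - 4 * p * n + 2 * p) (by linarith) (by linarith)
  have s6 := step hD 0 (b2 - 4 * p * n - 2 * p) (b2 - 4 * p * n + 2 * p) (by linarith) (by linarith)
  have t1 := step hD α (b2 - 4 * p * m) b2 (by linarith) (by linarith)
  have t2 := step hD α (b2 - 4 * p * m) (b2 + 4 * p) (by linarith) (by linarith)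
  have t3 := step hD α (b1 - 4 * p * m) b1 (by linarith) (by linarith)
  have t4 := step hD α (b1 - 4 * p * m - 4 * p) b1 (by linarith) (by linarith)
  rw [r1] at t3 hc
  rw [r2] at t4 hd
  simp only [ha, hb, hc, hd]
  clear ha hb hc hd r1 r2 hb1 hb2 hf0 hf1
  generalize b1 / (2 * w) = F1 at *
  generalize b2 / (2 * w) = F2 at *
  generalize (b2 + 2 * p) / (2 * w) = F3 at *
  generalize (b2 + 4 * p) / (2 * w) = F4 at *
  generalize (b2 - 4 * p * m) / (2 * w) = L2 at *
  generalize (b2 - 4 * p * n) / (2 * w) = B2 at *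
  generalize (b2 - 4 * p * n + 2 * p) / (2 * w) = B3 at *
  generalize (b2 - 4 * p * n - 2 * p) / (2 * w) = T3 at *
  split_ifs <;> omega

/-- The combinatorial core, when a `𝓟`-line meets the horizontal edges. -/
lemma coreB (p w m n α : ℤ) (hp : 0 < p) (hw : Odd w) (hpw : 2 * p < w)
    (hf0 : 2 * p * m < w * α + w) (hf1 : w * α + w ≤ 2 * p * m + 2 * p)
    (a b c d : Prop)
    (ha : a ↔ ¬ ((LZ p w n (n + α + 1)) ↔ (LZ p w n (n + 2 * m - α))))
    (hb : b ↔ ¬ ((LZ p w (n + 1) (n + α + 2)) ↔ (LZ p w (n + 1) (n + 2 * m - α + 1))))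
    (hc : c ↔ ¬ ((LZ p w m (n + α + 1)) ↔ (LZ p w m (n + 2 * m - α))))
    (hd : d ↔ ¬ ((LZ p w (m + 1) (n + α + 2)) ↔ (LZ p w (m + 1) (n + 2 * m - α + 1)))) :
    ((if a then 1 else 0) + (if b then 1 else 0) + (if c then 1 else 0) +
      (if d then 1 else 0) = 0) ∨
    ((if a then 1 else 0) + (if b then 1 else 0) + (if c then 1 else 0) +
      (if d then 1 else 0) = 2) := by
  rw [xor_LZ] at ha hb hc hd
  have hD : 0 < 2 * w := by linarith
  obtain ⟨b1, hb1⟩ : ∃ x, x = 2 * p * (n + α + 1) + w := ⟨_, rfl⟩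
  obtain ⟨b2, hb2⟩ : ∃ x, x = 2 * p * (n + 2 * m - α) + w := ⟨_, rfl⟩
  have e1 : 2 * p * (n + α + 1) + w = b1 := hb1.symm
  have e2 : 2 * p * (n + 2 * m - α) + w = b2 := hb2.symm
  have e3 : 2 * p * (n + α + 2) + w = b1 + 2 * p := by rw [hb1]; ring
  have e4 : 2 * p * (n + 2 * m - α + 1) + w = b2 + 2 * p := by rw [hb2]; ring
  rw [e1, e2] at ha hc
  rw [e3, e4] at hb hd
  rw [show b1 + 2 * p - 4 * p * (n + 1) = b1 - 4 * p * n - 2 * p by ring,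
    show b2 + 2 * p - 4 * p * (n + 1) = b2 - 4 * p * n - 2 * p by ring] at hb
  rw [show b1 + 2 * p - 4 * p * (m + 1) = b1 - 4 * p * m - 2 * p by ring,
    show b2 + 2 * p - 4 * p * (m + 1) = b2 - 4 * p * m - 2 * p by ring] at hd
  have o1 : ∀ t : ℤ, Odd (b1 + 2 * t) := fun t => by
    rw [hb1, show 2 * p * (n + α + 1) + w + 2 * t = w + 2 * (p * (n + α + 1) + t) by ring]
    exact hw.add_even ⟨p * (n + α + 1) + t, by ring⟩
  have o2 : ∀ t : ℤ, Odd (b2 + 2 * t) := fun t => by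
    rw [hb2, show 2 * p * (n + 2 * m - α) + w + 2 * t = w + 2 * (p * (n + 2 * m - α) + t) by ring]
    exact hw.add_even ⟨p * (n + 2 * m - α) + t, by ring⟩
  have r1 := refl_div hD (b1 - 4 * p * m) (b2 - 4 * p * n - 2 * p) (by rw [hb1, hb2]; ring)
    (not_dvd_odd (by convert o1 (-2 * p * m) using 1; ring))
  have r2 := refl_div hD (b2 - 4 * p * m) (b1 - 4 * p * n - 2 * p) (by rw [hb1, hb2]; ring)
    (not_dvd_odd (by convert o2 (-2 * p * m) using 1; ring))
  have r3 := refl_div hD (b1 - 4 * p * m - 2 * p) (b2 - 4 * p * n) (by rw [hb1, hb2]; ring)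
    (not_dvd_odd (by convert o1 (-2 * p * m - p) using 1; ring))
  have r4 := refl_div hD (b2 - 4 * p * m - 2 * p) (b1 - 4 * p * n) (by rw [hb1, hb2]; ring)
    (not_dvd_odd (by convert o2 (-2 * p * m - p) using 1; ring))
  have s1 := step hD 0 b1 (b1 + 2 * p) (by linarith) (by linarith)
  have s2 := step hD 0 b2 (b2 + 2 * p) (by linarith) (by linarith)
  have s3 := step hD 0 (b1 - 4 * p * n - 2 * p) (b1 - 4 * p * n) (by linarith) (by linarith)
  have s4 := step hD 0 (b2 - 4 * p * n - 2 * p) (b2 - 4 * p * n) (by linarith) (by linarith)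
  have t1 := step hD α (b1 - 4 * p * m) b1 (by linarith) (by linarith)
  have t2 := step hD α (b2 - 4 * p * m) b2 (by linarith) (by linarith)
  have t3 := step hD (α + 1) (b1 - 4 * p * m - 2 * p) (b1 + 2 * p) (by linarith) (by linarith)
  have t4 := step hD (α + 1) (b2 - 4 * p * m - 2 * p) (b2 + 2 * p) (by linarith) (by linarith)
  have key : ∃ k, (k = α ∨ k = α + 1) ∧ k * (2 * w) ≤ 4 * p * m + 2 * p ∧
      4 * p * m + 2 * p < (k + 1) * (2 * w) := by
    by_cases h : 4 * p * m + 2 * p < (α + 1) * (2 * w)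
    · exact ⟨α, Or.inl rfl, by linarith, h⟩
    · exact ⟨α + 1, Or.inr rfl, by linarith, by linarith⟩
  obtain ⟨k, hk, hk1, hk2⟩ := key
  have v1 := step hD k (b1 - 4 * p * m - 2 * p) b1 (by linarith) (by linarith)
  have v2 := step hD k (b2 - 4 * p * m - 2 * p) b2 (by linarith) (by linarith)
  have v3 := step hD k (b1 - 4 * p * m) (b1 + 2 * p) (by linarith) (by linarith)
  have v4 := step hD k (b2 - 4 * p * m) (b2 + 2 * p) (by linarith) (by linarith)
  rw [r1] at hc t1 v3
  rw [r2] at hc t2 v4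
  rw [r3] at hd t3 v1
  rw [r4] at hd t4 v2
  simp only [ha, hb, hc, hd]
  clear ha hb hc hd r1 r2 r3 r4 o1 o2 e1 e2 e3 e4 hb1 hb2 hf0 hf1 hk1 hk2
  generalize b1 / (2 * w) = F1 at *
  generalize b2 / (2 * w) = F2 at *
  generalize (b1 + 2 * p) / (2 * w) = G1 at *
  generalize (b2 + 2 * p) / (2 * w) = G2 at *
  generalize (b1 - 4 * p * n) / (2 * w) = B1 at *
  generalize (b2 - 4 * p * n) / (2 * w) = B2 at *
  generalize (b1 - 4 * p * n - 2 * p) / (2 * w) = T1 at *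
  generalize (b2 - 4 * p * n - 2 * p) / (2 * w) = T2 at *
  split_ifs <;> omega


lemma nrm_div {w : ℤ} (hw : 0 < w) (x : ℤ) :
    nrm ((x : ℝ) / (w : ℝ)) = ((x - 2 * w * ((x + w) / (2 * w)) : ℤ) : ℝ) / (w : ℝ) := by
  have hwr : (0 : ℝ) < w := by exact_mod_cast hw
  have hf : ⌊((x : ℝ) / (w : ℝ) + 1) / 2⌋ = (x + w) / (2 * w) := by
    rw [Int.floor_eq_iff]
    have e : ((x : ℝ) / (w : ℝ) + 1) / 2 = ((x + w : ℤ) : ℝ) / ((2 * w : ℤ) : ℝ) := by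
      push_cast; field_simp
    have hD : (0 : ℝ) < ((2 * w : ℤ) : ℝ) := by push_cast; linarith
    rw [e, le_div_iff₀ hD, div_lt_iff₀ hD]
    have h1 := Int.ediv_mul_le (x + w) (b := 2 * w) (by omega)
    have h2 := Int.lt_ediv_add_one_mul_self (x + w) (b := 2 * w) (by omega)
    exact ⟨by exact_mod_cast h1, by exact_mod_cast h2⟩
  unfold nrm
  rw [hf]
  push_cast
  field_simp

lemma lightPair_div {w : ℤ} (hw : 0 < w) (A B : ℤ) :
    lightPair ((A : ℝ) / (w : ℝ)) ((B : ℝ) / (w : ℝ)) ↔ (0 < B ∧ B < A) ∨ (A < B ∧ B < 0) := by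
  have hwr : (0 : ℝ) < w := by exact_mod_cast hw
  unfold lightPair
  have e1 : (A : ℝ) / w * ((B : ℝ) / w) > 0 ↔ 0 < A * B := by
    rw [div_mul_div_comm, gt_iff_lt, div_pos_iff_of_pos_right (by positivity)]
    exact_mod_cast Iff.rfl
  have e2 : |(B : ℝ) / w| < |(A : ℝ) / w| ↔ |B| < |A| := by
    rw [abs_div, abs_div, abs_of_pos hwr, div_lt_div_iff_of_pos_right hwr]
    exact_mod_cast Iff.rfl
  rw [e1, e2, mul_pos_iff]
  constructor
  · rintro ⟨⟨h1, h2⟩ | ⟨h1, h2⟩, h3⟩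
    · rw [abs_of_pos h1, abs_of_pos h2] at h3; omega
    · rw [abs_of_neg h1, abs_of_neg h2] at h3; omega
  · rintro (⟨h1, h2⟩ | ⟨h1, h2⟩)
    · have : 0 < A := by omega
      rw [abs_of_pos h1, abs_of_pos this]; omega
    · have : A < 0 := by omega
      rw [abs_of_neg h2, abs_of_neg this]; omega

lemma light_iff {p w : ℤ} (hw : 0 < w) (hodd : Odd w) (j k : ℤ) :
    lightPair (nrm (((4 * p * j : ℤ) : ℝ) / (w : ℝ))) (nrm (((2 * p * k + w : ℤ) : ℝ) / (w : ℝ))) ↔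
      LZ p w j k := by
  rw [nrm_div hw, nrm_div hw, lightPair_div hw]
  unfold LZ
  have hD : 0 < 2 * w := by omega
  obtain ⟨a, ha⟩ : ∃ x, x = 4 * p * j := ⟨_, rfl⟩
  obtain ⟨b, hb⟩ : ∃ x, x = 2 * p * k + w := ⟨_, rfl⟩
  rw [← ha, ← hb]
  have a1 := Int.mul_ediv_add_emod (a + w) (2 * w)
  have a2 := Int.emod_nonneg (a + w) hD.ne'
  have a3 := Int.emod_lt_of_pos (a + w) hD
  have b1 := Int.mul_ediv_add_emod (b + w) (2 * w)
  have b2 := Int.emod_nonneg (b + w) hD.ne'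
  have b3 := Int.emod_lt_of_pos (b + w) hD
  have hbo : ∀ t, b ≠ 2 * t := by
    intro t ht
    obtain ⟨c, hc⟩ := hodd
    rw [hb] at ht
    have : 2 * (p * k) + (2 * c + 1) = 2 * t := by rw [← hc]; linarith
    omega
  generalize (a + w) / (2 * w) = u at *
  generalize (b + w) / (2 * w) = v at *
  generalize (a + w) % (2 * w) = r at *
  generalize (b + w) % (2 * w) = s at *
  have hA : a - 2 * w * u = r - w := by linarith
  have hB : b - 2 * w * v = s - w := by linarith
  rw [hA, hB]
  have hs : s ≠ w := by
    intro h
    exact hbo (w * v) (by rw [h] at b1; linarith)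
  have hrs : s ≠ r := by
    intro h
    exact hbo (w * v - w * u + 2 * p * j) (by rw [h] at b1; linarith)
  have d1 : b / (2 * w) = (s - w) / (2 * w) + v := by
    rw [← Int.add_mul_ediv_right _ _ hD.ne']; congr 1; linarith
  have d2 : (b - a) / (2 * w) = (s - r) / (2 * w) + (v - u) := by
    rw [← Int.add_mul_ediv_right _ _ hD.ne']; congr 1; linarith
  have e1 : (s - w) / (2 * w) = if s < w then -1 else 0 := by
    split_ifs with h
    · rw [Int.ediv_eq_iff_of_pos hD]; constructor <;> linarith
    · exact Int.ediv_eq_zero_of_lt (by omega) (by omega)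
  have e2 : (s - r) / (2 * w) = if s < r then -1 else 0 := by
    split_ifs with h
    · rw [Int.ediv_eq_iff_of_pos hD]; constructor <;> linarith
    · exact Int.ediv_eq_zero_of_lt (by omega) (by omega)
  rw [d1, d2, e1, e2, Int.odd_iff]
  split_ifs <;> omega

lemma LZ_dark {p w m α : ℤ} (hw : 0 < w) (h : w * α = 2 * p * m) (k : ℤ) : ¬ LZ p w m k := by
  unfold LZ
  have hD : (2 * w) ≠ 0 := by omega
  have e1 : 2 * p * k + w - 4 * p * m = 2 * p * k + w + (-α) * (2 * w) := by linarith
  have e2 : 4 * p * m + w = w + α * (2 * w) := by linarith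
  rw [e1, e2, Int.add_mul_ediv_right _ _ hD, Int.add_mul_ediv_right _ _ hD,
    Int.ediv_eq_zero_of_lt hw.le (by omega : w < 2 * w), Int.odd_iff]
  omega

lemma LZ_symm {p w m n α : ℤ} (hw : 0 < w) (hodd : Odd w) (h : w * α = 2 * p * m) :
    LZ p w n (n + α) ↔ LZ p w n (n + 2 * m - α) := by
  unfold LZ
  have hD : 0 < 2 * w := by omega
  have o : ∀ t : ℤ, ¬ (2 * w) ∣ (w + 2 * t) := fun t =>
    not_dvd_odd (hodd.add_even ⟨t, by ring⟩)
  have e1 := Int.add_mul_ediv_right (2 * p * (n + α) + w) (-α) hD.ne'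
  have e2 := Int.add_mul_ediv_right (2 * p * (n + 2 * m - α) + w) (-α) hD.ne'
  have r1 := refl_div hD (2 * p * (n + α) + w + -α * (2 * w))
    (2 * p * (n + 2 * m - α) + w - 4 * p * n) (by linarith) (by
      convert o (p * (n + α) - α * w) using 1; ring)
  have r2 := refl_div hD (2 * p * (n + 2 * m - α) + w + -α * (2 * w))
    (2 * p * (n + α) + w - 4 * p * n) (by linarith) (by
      convert o (p * (n + 2 * m - α) - α * w) using 1; ring)
  rw [Int.odd_iff, Int.odd_iff]
  omega

lemma ncard_one (c : ℤ) (A : Prop) : Set.ncard {k : ℤ | k = c ∧ A} = if A then 1 else 0 := by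
  by_cases h : A <;> simp [h]

lemma ncard_two (c d : ℤ) (hcd : c ≠ d) (A B : Prop) :
    Set.ncard {k : ℤ | (k = c ∧ A) ∨ (k = d ∧ B)} =
      (if A then 1 else 0) + (if B then 1 else 0) := by
  by_cases h : A <;> by_cases h' : B <;> simp [h, h']
  exact Set.ncard_pair hcd

end PlaidAux

namespace Param

open PlaidAux

variable (π : Param)

lemma w_pos : (0 : ℤ) < (π.ω : ℤ) := by
  have := π.p_pos; unfold ω; push_cast; omega

lemma w_odd : Odd (π.ω : ℤ) := by
  have h1 := π.even_pq
  have h2 := π.coprime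
  unfold ω
  rw [Int.odd_coe_nat, Nat.odd_add]
  rw [Nat.even_mul] at h1
  rcases Nat.even_or_odd π.p with hp | hp <;> rcases Nat.even_or_odd π.q with hq | hq
  · exact absurd (Nat.dvd_gcd hp.two_dvd hq.two_dvd) (by rw [h2.gcd_eq_one]; omega)
  · simp [Nat.not_odd_iff_even.mpr hp, Nat.not_even_iff_odd.mpr hq]
  · simp [hp, hq]
  · rcases h1 with h | h
    · exact absurd h (Nat.not_even_iff_odd.mpr hp)
    · exact absurd h (Nat.not_even_iff_odd.mpr hq)

lemma w_real : (0 : ℝ) < ((π.ω : ℤ) : ℝ) := by exact_mod_cast π.w_pos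

lemma P_eq : π.P = 2 * ((π.p : ℤ) : ℝ) / ((π.ω : ℤ) : ℝ) := by unfold P; push_cast; rfl

lemma Q_eq : π.Q = 2 * ((π.q : ℤ) : ℝ) / ((π.ω : ℤ) : ℝ) := by unfold Q; push_cast; rfl

lemma light_aux (j k : ℤ) (c b : ℝ) (hc : c = 2 * π.P * j) (hb : b = π.P * k + 1) :
    lightPair (nrm c) (nrm b) ↔ LZ π.p π.ω j k := by
  rw [← light_iff π.w_pos π.w_odd]
  have h0 : ((π.ω : ℤ) : ℝ) ≠ 0 := π.w_real.ne'
  rw [show c = ((4 * (π.p : ℤ) * j : ℤ) : ℝ) / ((π.ω : ℤ) : ℝ) by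
      rw [hc, P_eq, Int.cast_mul, Int.cast_mul]; norm_num; ring,
    show b = ((2 * (π.p : ℤ) * k + (π.ω : ℤ) : ℤ) : ℝ) / ((π.ω : ℤ) : ℝ) by
      rw [hb, P_eq, Int.cast_add, add_div, div_self h0, Int.cast_mul, Int.cast_mul]; norm_num; ring]

lemma lightHP_iff (x : ℝ) (n : ℤ) :
    π.lightHP (x, (n : ℝ)) ↔ ∃ k : ℤ, (n : ℝ) + π.P * x = k ∧ LZ π.p π.ω n k := by
  unfold lightHP onP onH FH FP
  constructor
  · rintro ⟨-, ⟨k, hk⟩, h⟩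
    exact ⟨k, hk, (π.light_aux n k _ _ rfl (by simp only at hk ⊢; rw [← hk]; ring)).1 h⟩
  · rintro ⟨k, hk, h⟩
    exact ⟨⟨n, rfl⟩, ⟨k, hk⟩, (π.light_aux n k _ _ rfl (by simp only; rw [← hk]; ring)).2 h⟩

lemma lightHQ_iff (x : ℝ) (n : ℤ) :
    π.lightHQ (x, (n : ℝ)) ↔ ∃ k : ℤ, (n : ℝ) + π.Q * x = k ∧ LZ π.p π.ω n k := by
  unfold lightHQ onQ onH FH FQ
  constructor
  · rintro ⟨-, ⟨k, hk⟩, h⟩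
    exact ⟨k, hk, (π.light_aux n k _ _ rfl (by simp only at hk ⊢; rw [← hk]; ring)).1 h⟩
  · rintro ⟨k, hk, h⟩
    exact ⟨⟨n, rfl⟩, ⟨k, hk⟩, (π.light_aux n k _ _ rfl (by simp only; rw [← hk]; ring)).2 h⟩

lemma lightVP_iff (m : ℤ) (y : ℝ) :
    π.lightVP ((m : ℝ), y) ↔ ∃ k : ℤ, y + π.P * m = k ∧ LZ π.p π.ω m k := by
  unfold lightVP onP onV FV FP
  constructor
  · rintro ⟨-, ⟨k, hk⟩, h⟩
    exact ⟨k, hk, (π.light_aux m k _ _ rfl (by simp only at hk ⊢; rw [← hk]; ring)).1 h⟩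
  · rintro ⟨k, hk, h⟩
    exact ⟨⟨m, rfl⟩, ⟨k, hk⟩, (π.light_aux m k _ _ rfl (by simp only; rw [← hk]; ring)).2 h⟩

lemma lightVQ_iff (m : ℤ) (y : ℝ) :
    π.lightVQ ((m : ℝ), y) ↔ ∃ k : ℤ, y + π.Q * m = k ∧ LZ π.p π.ω m k := by
  unfold lightVQ onQ onV FV FQ
  constructor
  · rintro ⟨-, ⟨k, hk⟩, h⟩
    exact ⟨k, hk, (π.light_aux m k _ _ rfl (by simp only at hk ⊢; rw [← hk]; ring)).1 h⟩
  · rintro ⟨k, hk, h⟩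
    exact ⟨⟨m, rfl⟩, ⟨k, hk⟩, (π.light_aux m k _ _ rfl (by simp only; rw [← hk]; ring)).2 h⟩

end Param

namespace PlaidAux

/-- Transfer of a vertical count to an integer count. -/
lemma vset {r w : ℤ} (hw : 0 < w) (R : ℝ) (hR : R = 2 * (r : ℝ) / (w : ℝ)) (m n : ℤ)
    (A : ℤ → Prop) (C : ℝ → Prop) (hC : ∀ y, C y ↔ ∃ k : ℤ, y + R * m = k ∧ A k) :
    Set.ncard {y : ℝ | y ∈ Set.Icc (n : ℝ) ((n : ℝ) + 1) ∧ C y} =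
    Set.ncard {k : ℤ | w * n ≤ w * k - 2 * r * m ∧ w * k - 2 * r * m ≤ w * n + w ∧ A k} := by
  have hwr : (0 : ℝ) < w := by exact_mod_cast hw
  have hRw : R * w = 2 * r := by rw [hR]; field_simp
  have key : ∀ k : ℤ, ((k : ℝ) - R * m ∈ Set.Icc (n : ℝ) ((n : ℝ) + 1)) ↔
      w * n ≤ w * k - 2 * r * m ∧ w * k - 2 * r * m ≤ w * n + w := by
    intro k
    rw [Set.mem_Icc, ← mul_le_mul_iff_right₀ (b := (n : ℝ)) hwr,
      ← mul_le_mul_iff_right₀ (c := (n : ℝ) + 1) hwr]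
    have e : (w : ℝ) * (k - R * m) = w * k - 2 * r * m := by
      rw [← hRw]; ring
    rw [e, mul_add, mul_one]
    exact_mod_cast Iff.rfl
  have hinj : Function.Injective (fun k : ℤ => (k : ℝ) - R * m) := by
    intro a b h
    simpa using h
  rw [← Set.ncard_image_of_injective _ hinj]
  congr 1
  ext y
  simp only [Set.mem_ofPred_eq, Set.mem_image, hC]
  constructor
  · rintro ⟨h1, k, h2, h3⟩
    have e : y = k - R * m := by linarith
    rw [e, key] at h1
    exact ⟨k, ⟨h1.1, h1.2, h3⟩, e.symm⟩
  · rintro ⟨k, ⟨h1, h2, h3⟩, rfl⟩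
    exact ⟨(key k).2 ⟨h1, h2⟩, k, by ring, h3⟩

/-- Transfer of a horizontal count to an integer count. -/
lemma hset {r w : ℤ} (hw : 0 < w) (hr : 0 < r) (R : ℝ) (hR : R = 2 * (r : ℝ) / (w : ℝ)) (m n : ℤ)
    (A B : ℤ → Prop) (C D : ℝ → Prop) (hC : ∀ x, C x ↔ ∃ k : ℤ, (n : ℝ) + R * x = k ∧ A k)
    (hB : ∀ (x : ℝ) (k : ℤ), (n : ℝ) + R * x = k → (D x ↔ B k)) :
    Set.ncard {x : ℝ | x ∈ Set.Icc (m : ℝ) ((m : ℝ) + 1) ∧ C x ∧ D x} =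
    Set.ncard {k : ℤ | 2 * r * m ≤ w * (k - n) ∧ w * (k - n) ≤ 2 * r * (m + 1) ∧ A k ∧ B k} := by
  have hwr : (0 : ℝ) < w := by exact_mod_cast hw
  have hrr : (0 : ℝ) < r := by exact_mod_cast hr
  have hRw : R * w = 2 * r := by rw [hR]; field_simp
  have hR0 : 0 < R := by rw [hR]; positivity
  have key : ∀ (x : ℝ) (k : ℤ), (n : ℝ) + R * x = k → (x ∈ Set.Icc (m : ℝ) ((m : ℝ) + 1) ↔
      2 * r * m ≤ w * (k - n) ∧ w * (k - n) ≤ 2 * r * (m + 1)) := by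
    intro x k h
    have h2r : (0 : ℝ) < 2 * r := by positivity
    rw [Set.mem_Icc, ← mul_le_mul_iff_right₀ (b := (m : ℝ)) h2r,
      ← mul_le_mul_iff_right₀ (c := (m : ℝ) + 1) h2r]
    have e : (2 * r : ℝ) * x = w * (k - n) := by
      rw [← hRw, ← h]; ring
    rw [e]
    exact_mod_cast Iff.rfl
  have hinj : Function.Injective (fun k : ℤ => ((k : ℝ) - n) / R) := by
    intro a b h
    simp only at h
    rw [div_left_inj' hR0.ne'] at h
    have : (a : ℝ) = b := by linarith
    exact_mod_cast this
  rw [← Set.ncard_image_of_injective _ hinj]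
  congr 1
  ext x
  simp only [Set.mem_ofPred_eq, Set.mem_image, hC]
  constructor
  · rintro ⟨h1, ⟨k, h2, h3⟩, h4⟩
    have h1 := (key x k h2).1 h1
    exact ⟨k, ⟨h1.1, h1.2, h3, (hB x k h2).1 h4⟩, by rw [← h2]; field_simp; ring⟩
  · rintro ⟨k, ⟨h1, h2, h3, h4⟩, rfl⟩
    have e : (n : ℝ) + R * (((k : ℝ) - n) / R) = k := by field_simp; ring
    exact ⟨(key _ k e).2 ⟨h1, h2⟩, ⟨k, e, h3⟩, (hB _ k e).2 h4⟩

lemma pin {w : ℤ} (hw : 0 < w) (t c : ℤ) (h1 : w * (c - 1) < w * t) (h2 : w * t < w * (c + 1)) :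
    t = c := by
  have := lt_of_mul_lt_mul_left h1 hw.le
  have := lt_of_mul_lt_mul_left h2 hw.le
  omega

end PlaidAux

namespace Param

open PlaidAux

variable (π : Param)

lemma w_eq : (π.ω : ℤ) = π.p + π.q := by unfold ω; push_cast; rfl

lemma coprime_q_w : IsCoprime (π.q : ℤ) (π.ω : ℤ) := by
  obtain ⟨a, b, h⟩ := Nat.isCoprime_iff_coprime.2 π.coprime
  rw [w_eq]
  exact ⟨b - a, a, by linarith⟩

lemma onP_iff (x : ℝ) (n k : ℤ) (h : (n : ℝ) + π.Q * x = k) :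
    π.onP (x, (n : ℝ)) ↔ (π.q : ℤ) ∣ k - n := by
  have h0 : ((π.ω : ℤ) : ℝ) ≠ 0 := π.w_real.ne'
  have hq : (0 : ℝ) < ((π.q : ℤ) : ℝ) := by
    have := π.p_lt_q; exact_mod_cast (by omega : 0 < π.q)
  have hPQ : ((π.q : ℤ) : ℝ) * π.P = ((π.p : ℤ) : ℝ) * π.Q := by
    rw [P_eq, Q_eq]; ring
  unfold onP
  constructor
  · rintro ⟨l, hl⟩
    simp only at hl
    have e : (π.q : ℤ) * (l - n) = (π.p : ℤ) * (k - n) := by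
      have : ((π.q : ℤ) : ℝ) * ((l : ℝ) - n) = ((π.p : ℤ) : ℝ) * ((k : ℝ) - n) := by
        rw [← hl, ← h]; linear_combination x * hPQ
      exact_mod_cast this
    have hc : IsCoprime (π.q : ℤ) (π.p : ℤ) := (Nat.isCoprime_iff_coprime.2 π.coprime).symm
    exact hc.dvd_of_dvd_mul_left ⟨l - n, e.symm⟩
  · rintro ⟨t, ht⟩
    refine ⟨n + π.p * t, ?_⟩
    have ht' : (k : ℝ) - n = ((π.q : ℤ) : ℝ) * t := by exact_mod_cast ht
    have : ((π.q : ℤ) : ℝ) * (π.P * x) = ((π.q : ℤ) : ℝ) * (((π.p : ℤ) : ℝ) * t) := by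
      linear_combination x * hPQ + ((π.p : ℤ) : ℝ) * h + ((π.p : ℤ) : ℝ) * ht'
    have := mul_left_cancel₀ hq.ne' this
    push_cast at this ⊢
    linarith

lemma hcount (m n : ℤ) : π.hLightCount m n =
    Set.ncard {k : ℤ | 2 * (π.p : ℤ) * m ≤ π.ω * (k - n) ∧ π.ω * (k - n) ≤ 2 * (π.p : ℤ) * (m + 1) ∧
      LZ π.p π.ω n k} +
    Set.ncard {k : ℤ | 2 * (π.q : ℤ) * m < π.ω * (k - n) ∧ π.ω * (k - n) < 2 * (π.q : ℤ) * (m + 1) ∧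
      LZ π.p π.ω n k} := by
  have hp0 : (0 : ℤ) < π.p := by exact_mod_cast π.p_pos
  have hq0 : (0 : ℤ) < π.q := by have := π.p_lt_q; omega
  have h1 := hset π.w_pos hp0 π.P π.P_eq m n (LZ π.p π.ω n) (fun _ => True)
    (fun x => π.lightHP (x, (n : ℝ))) (fun _ => True) (fun x => π.lightHP_iff x n)
    (fun _ _ _ => Iff.rfl)
  have h2 := hset π.w_pos hq0 π.Q π.Q_eq m n (LZ π.p π.ω n)
    (fun k => (π.q : ℤ) ∣ k - n → (π.ω : ℤ) * (k - n) = π.q * (2 * m + 1))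
    (fun x => π.lightHQ (x, (n : ℝ))) (fun x => π.onP (x, (n : ℝ)) → x = (m : ℝ) + 1 / 2)
    (fun x => π.lightHQ_iff x n) (by
      intro x k h
      rw [π.onP_iff x n k h]
      refine imp_congr_right fun _ => ?_
      have hqr : (0 : ℝ) < ((π.q : ℤ) : ℝ) := by exact_mod_cast hq0
      have hwr := π.w_real
      have hQw : π.Q * ((π.ω : ℤ) : ℝ) = 2 * ((π.q : ℤ) : ℝ) := by
        rw [Q_eq, div_mul_cancel₀ _ hwr.ne']
      have e : ((π.ω : ℤ) : ℝ) * ((k : ℝ) - n) = ((π.q : ℤ) : ℝ) * (2 * x) := by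
        rw [← h]; linear_combination x * hQw
      constructor
      · intro hx
        have : ((π.ω : ℤ) : ℝ) * ((k : ℝ) - n) = ((π.q : ℤ) : ℝ) * (2 * m + 1) := by
          rw [e, hx]; ring
        exact_mod_cast this
      · intro hx
        have : ((π.ω : ℤ) : ℝ) * ((k : ℝ) - n) = ((π.q : ℤ) : ℝ) * (2 * m + 1) := by
          exact_mod_cast hx
        rw [e] at this
        have := mul_left_cancel₀ hqr.ne' this
        linarith)
  simp only [and_true] at h1
  unfold hLightCount
  rw [h1, h2]
  congr 2
  ext k
  simp only [Set.mem_ofPred_eq]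
  constructor
  · rintro ⟨a1, a2, a3, a4⟩
    refine ⟨lt_of_le_of_ne a1 ?_, lt_of_le_of_ne a2 ?_, a3⟩
    · intro h
      have hd : (π.q : ℤ) ∣ k - n := π.coprime_q_w.dvd_of_dvd_mul_left ⟨2 * m, by rw [← h]; ring⟩
      have := a4 hd
      rw [← h] at this
      linarith
    · intro h
      have hd : (π.q : ℤ) ∣ k - n :=
        π.coprime_q_w.dvd_of_dvd_mul_left ⟨2 * (m + 1), by rw [h]; ring⟩
      have := a4 hd
      rw [h] at this
      linarith
  · rintro ⟨a1, a2, a3⟩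
    refine ⟨a1.le, a2.le, a3, ?_⟩
    rintro ⟨t, ht⟩
    rw [ht] at a1 a2 ⊢
    have b1 : 2 * m < π.ω * t := by
      refine lt_of_mul_lt_mul_left (a := (π.q : ℤ)) ?_ hq0.le
      linarith
    have b2 : π.ω * t < 2 * (m + 1) := by
      refine lt_of_mul_lt_mul_left (a := (π.q : ℤ)) ?_ hq0.le
      linarith
    have b3 : π.ω * t = 2 * m + 1 := by linarith
    rw [← b3]; ring

lemma goodH_A (m n α : ℤ) (hf0 : π.ω * α ≤ 2 * (π.p : ℤ) * m)
    (hf1 : 2 * (π.p : ℤ) * m + 2 * π.p < π.ω * α + π.ω) :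
    π.goodH m n ↔ ¬ (LZ π.p π.ω n (n + 2 * m - α) ↔ LZ π.p π.ω n (n + 2 * m - α + 1)) := by
  unfold goodH
  rw [hcount]
  have hp0 : (0 : ℤ) < π.p := by exact_mod_cast π.p_pos
  have hq : (π.q : ℤ) = π.ω - π.p := by rw [w_eq]; ring
  have hw := π.w_pos
  have hodd := π.w_odd
  rw [hq]
  generalize (π.ω : ℤ) = w at *
  generalize (π.p : ℤ) = p at *
  rcases eq_or_lt_of_le hf0 with h | h
  · have e1 : {k : ℤ | 2 * p * m ≤ w * (k - n) ∧ w * (k - n) ≤ 2 * p * (m + 1) ∧ LZ p w n k} =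
        {k : ℤ | k = n + α ∧ LZ p w n (n + α)} := by
      ext k
      simp only [Set.mem_ofPred_eq]
      constructor
      · rintro ⟨a1, a2, a3⟩
        have : k - n = α := pin hw _ _ (by linarith) (by linarith)
        obtain rfl : k = n + α := by omega
        exact ⟨rfl, a3⟩
      · rintro ⟨rfl, a3⟩
        exact ⟨by linarith, by linarith, a3⟩
    have e2 : {k : ℤ | 2 * (w - p) * m < w * (k - n) ∧ w * (k - n) < 2 * (w - p) * (m + 1) ∧
        LZ p w n k} = {k : ℤ | k = n + 2 * m - α + 1 ∧ LZ p w n (n + 2 * m - α + 1)} := by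
      ext k
      simp only [Set.mem_ofPred_eq]
      constructor
      · rintro ⟨a1, a2, a3⟩
        have : k - n - 2 * m + α = 1 := pin hw _ _ (by linarith) (by linarith)
        obtain rfl : k = n + 2 * m - α + 1 := by omega
        exact ⟨rfl, a3⟩
      · rintro ⟨rfl, a3⟩
        exact ⟨by linarith, by linarith, a3⟩
    rw [e1, e2, ncard_one, ncard_one, LZ_symm hw hodd h]
    split_ifs <;> simp [*]
  · have e1 : {k : ℤ | 2 * p * m ≤ w * (k - n) ∧ w * (k - n) ≤ 2 * p * (m + 1) ∧ LZ p w n k} =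
        ∅ := by
      ext k
      simp only [Set.mem_ofPred_eq, Set.mem_empty_iff_false, iff_false]
      rintro ⟨a1, a2, a3⟩
      have h1 : w * α < w * (k - n) := by linarith
      have h2 : w * (k - n) < w * (α + 1) := by linarith
      have := lt_of_mul_lt_mul_left h1 hw.le
      have := lt_of_mul_lt_mul_left h2 hw.le
      omega
    have e2 : {k : ℤ | 2 * (w - p) * m < w * (k - n) ∧ w * (k - n) < 2 * (w - p) * (m + 1) ∧
        LZ p w n k} = {k : ℤ | (k = n + 2 * m - α ∧ LZ p w n (n + 2 * m - α)) ∨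
          (k = n + 2 * m - α + 1 ∧ LZ p w n (n + 2 * m - α + 1))} := by
      ext k
      simp only [Set.mem_ofPred_eq]
      constructor
      · rintro ⟨a1, a2, a3⟩
        have h1 : w * (-1) < w * (k - n - 2 * m + α) := by linarith
        have h2 : w * (k - n - 2 * m + α) < w * 2 := by linarith
        have h1 := lt_of_mul_lt_mul_left h1 hw.le
        have h2 := lt_of_mul_lt_mul_left h2 hw.le
        have : k = n + 2 * m - α ∨ k = n + 2 * m - α + 1 := by omega
        rcases this with rfl | rfl
        · exact Or.inl ⟨rfl, a3⟩
        · exact Or.inr ⟨rfl, a3⟩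
      · rintro (⟨rfl, a3⟩ | ⟨rfl, a3⟩)
        · exact ⟨by linarith, by linarith, a3⟩
        · exact ⟨by linarith, by linarith, a3⟩
    rw [e1, e2, ncard_two _ _ (by omega), Set.ncard_empty]
    split_ifs <;> simp [*]

lemma goodH_B (m n α : ℤ) (hpw : 2 * (π.p : ℤ) < π.ω) (hf0 : 2 * (π.p : ℤ) * m < π.ω * α + π.ω)
    (hf1 : π.ω * α + π.ω ≤ 2 * (π.p : ℤ) * m + 2 * π.p) :
    π.goodH m n ↔ ¬ (LZ π.p π.ω n (n + α + 1) ↔ LZ π.p π.ω n (n + 2 * m - α)) := by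
  unfold goodH
  rw [hcount]
  have hp0 : (0 : ℤ) < π.p := by exact_mod_cast π.p_pos
  have hq : (π.q : ℤ) = π.ω - π.p := by rw [w_eq]; ring
  have hw := π.w_pos
  rw [hq]
  generalize (π.ω : ℤ) = w at *
  generalize (π.p : ℤ) = p at *
  have e1 : {k : ℤ | 2 * p * m ≤ w * (k - n) ∧ w * (k - n) ≤ 2 * p * (m + 1) ∧ LZ p w n k} =
      {k : ℤ | k = n + α + 1 ∧ LZ p w n (n + α + 1)} := by
    ext k
    simp only [Set.mem_ofPred_eq]
    constructor
    · rintro ⟨a1, a2, a3⟩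
      have : k - n - α = 1 := pin hw _ _ (by linarith) (by linarith)
      obtain rfl : k = n + α + 1 := by omega
      exact ⟨rfl, a3⟩
    · rintro ⟨rfl, a3⟩
      exact ⟨by linarith, by linarith, a3⟩
  have e2 : {k : ℤ | 2 * (w - p) * m < w * (k - n) ∧ w * (k - n) < 2 * (w - p) * (m + 1) ∧
      LZ p w n k} = {k : ℤ | k = n + 2 * m - α ∧ LZ p w n (n + 2 * m - α)} := by
    ext k
    simp only [Set.mem_ofPred_eq]
    constructor
    · rintro ⟨a1, a2, a3⟩
      have : k - n - 2 * m + α = 0 := pin hw _ _ (by linarith) (by linarith)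
      obtain rfl : k = n + 2 * m - α := by omega
      exact ⟨rfl, a3⟩
    · rintro ⟨rfl, a3⟩
      exact ⟨by linarith, by linarith, a3⟩
  rw [e1, e2, ncard_one, ncard_one]
  split_ifs <;> simp [*]

lemma goodV_iff (m n α : ℤ) (hf0 : π.ω * α ≤ 2 * (π.p : ℤ) * m)
    (hf1 : 2 * (π.p : ℤ) * m < π.ω * α + π.ω) :
    π.goodV m n ↔ ¬ (LZ π.p π.ω m (n + α + 1) ↔ LZ π.p π.ω m (n + 2 * m - α)) := by
  unfold goodV vLightCount
  rw [vset π.w_pos π.P π.P_eq m n (LZ π.p π.ω m) _ (fun y => π.lightVP_iff m y),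
    vset π.w_pos π.Q π.Q_eq m n (LZ π.p π.ω m) _ (fun y => π.lightVQ_iff m y)]
  have hp0 : (0 : ℤ) < π.p := by exact_mod_cast π.p_pos
  have hq : (π.q : ℤ) = π.ω - π.p := by rw [w_eq]; ring
  have hw := π.w_pos
  rw [hq]
  generalize (π.ω : ℤ) = w at *
  generalize (π.p : ℤ) = p at *
  rcases eq_or_lt_of_le hf0 with h | h
  · have := LZ_dark hw h
    simp [this]
  have e1 : {k : ℤ | w * n ≤ w * k - 2 * p * m ∧ w * k - 2 * p * m ≤ w * n + w ∧ LZ p w m k} =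
      {k : ℤ | k = n + α + 1 ∧ LZ p w m (n + α + 1)} := by
    ext k
    simp only [Set.mem_ofPred_eq]
    constructor
    · rintro ⟨a1, a2, a3⟩
      have : k - n - α = 1 := pin hw _ _ (by linarith) (by linarith)
      obtain rfl : k = n + α + 1 := by omega
      exact ⟨rfl, a3⟩
    · rintro ⟨rfl, a3⟩
      exact ⟨by linarith, by linarith, a3⟩
  have e2 : {k : ℤ | w * n ≤ w * k - 2 * (w - p) * m ∧ w * k - 2 * (w - p) * m ≤ w * n + w ∧
      LZ p w m k} = {k : ℤ | k = n + 2 * m - α ∧ LZ p w m (n + 2 * m - α)} := by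
    ext k
    simp only [Set.mem_ofPred_eq]
    constructor
    · rintro ⟨a1, a2, a3⟩
      have : k - n - 2 * m + α = 0 := pin hw _ _ (by linarith) (by linarith)
      obtain rfl : k = n + 2 * m - α := by omega
      exact ⟨rfl, a3⟩
    · rintro ⟨rfl, a3⟩
      exact ⟨by linarith, by linarith, a3⟩
  rw [e1, e2, ncard_one, ncard_one]
  split_ifs <;> simp [*]

end Param

/-- **The Fundamental Theorem** (coherence of the plaid model).  For every even rational
parameter `p/q`, every integer unit square (the square with corners `(m,n)` and `(m+1,n+1)`)
contains either `0` or `2` good edges. -/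
theorem plaid_coherent (π : Param) (m n : ℤ) :
    ((if π.goodH m n then 1 else 0) + (if π.goodH m (n + 1) then 1 else 0) +
        (if π.goodV m n then 1 else 0) + (if π.goodV (m + 1) n then 1 else 0) = 0) ∨
    ((if π.goodH m n then 1 else 0) + (if π.goodH m (n + 1) then 1 else 0) +
        (if π.goodV m n then 1 else 0) + (if π.goodV (m + 1) n then 1 else 0) = 2) := by
  have hp0 : (0 : ℤ) < π.p := by exact_mod_cast π.p_pos
  have hpw : 2 * (π.p : ℤ) < π.ω := by
    have := π.p_lt_q
    rw [Param.w_eq]; omega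
  have hw := π.w_pos
  have h1 := Int.ediv_mul_le (2 * (π.p : ℤ) * m) (b := (π.ω : ℤ)) hw.ne'
  have h2 := Int.lt_ediv_add_one_mul_self (2 * (π.p : ℤ) * m) (b := (π.ω : ℤ)) hw
  generalize (2 * (π.p : ℤ) * m) / (π.ω : ℤ) = α at *
  have hc := π.goodV_iff m n α (by linarith) (by linarith)
  by_cases h : 2 * (π.p : ℤ) * m + 2 * π.p < π.ω * α + π.ω
  · have ha := π.goodH_A m n α (by linarith) h
    have hb := π.goodH_A m (n + 1) α (by linarith) h
    have hd := π.goodV_iff (m + 1) n α (by linarith) (by linarith)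
    rw [show n + 1 + 2 * m - α = n + 2 * m - α + 1 by ring,
      show n + 2 * m - α + 1 + 1 = n + 2 * m - α + 2 by ring] at hb
    rw [show n + 2 * (m + 1) - α = n + 2 * m - α + 2 by ring] at hd
    exact PlaidAux.coreA π.p π.ω m n α hp0 π.w_odd hpw (by linarith) h _ _ _ _ ha hb hc hd
  · push Not at h
    have ha := π.goodH_B m n α hpw (by linarith) h
    have hb := π.goodH_B m (n + 1) α hpw (by linarith) h
    have hd := π.goodV_iff (m + 1) n (α + 1) (by linarith) (by linarith)
    rw [show n + 1 + 2 * m - α = n + 2 * m - α + 1 by ring,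
      show n + 1 + α + 1 = n + α + 2 by ring] at hb
    rw [show n + 2 * (m + 1) - (α + 1) = n + 2 * m - α + 1 by ring,
      show n + (α + 1) + 1 = n + α + 2 by ring] at hd
    exact PlaidAux.coreB π.p π.ω m n α hp0 π.w_odd hpw (by linarith) h _ _ _ _ ha hb hc hd
end
end

section
/- For every block B and every even integer k with 0 ≤ k ≤ ω−1, exactly 2 lines of 𝓗 of capacity k intersect B, and exactly 2 lines of 𝓥 of capacity k intersect B. -/
noncomputable section
open scoped Classical

namespace Param

variable (π : Param)

/-- The capacity of the horizontal line `y = c` of `𝓗` — and likewise of the vertical line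
`x = c` of `𝓥`, since `F_V` is given by the same formula: `ω·|F_H|`. -/
def cap (c : ℤ) : ℝ := π.ω * |nrm (2 * π.P * c)|

/-- The mass of the `𝓟` line with `y`-intercept `(0,c)` — and likewise of the `𝓠` line with
`y`-intercept `(0,c)`, since `F_P` and `F_Q` restrict to the same value on these lines. -/
def mass (c : ℤ) : ℝ := π.ω * |nrm (π.P * c + 1)|

/-- The block indexed by `(i,j)` : the translate of the square `[0,ω]²` by the lattice
vector `(ω² i, ω j)`. -/
def block (i j : ℤ) : Set (ℝ × ℝ) :=
  Set.Icc ((π.ω : ℝ) ^ 2 * i, (π.ω : ℝ) * j) ((π.ω : ℝ) ^ 2 * i + π.ω, (π.ω : ℝ) * j + π.ω)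

end Param

/-- The capacity is `2|2pc - ωn|` for the integer `n` with `-ω ≤ 2(2pc - ωn) < ω`. -/
lemma cap_form (π : Param) (c : ℤ) : ∃ n : ℤ,
    -(π.ω : ℤ) ≤ 2 * (2 * π.p * c - π.ω * n) ∧ 2 * (2 * π.p * c - π.ω * n) < (π.ω : ℤ) ∧
    π.cap c = ((2 * |2 * (π.p : ℤ) * c - π.ω * n| : ℤ) : ℝ) := by
  have hω : (0 : ℝ) < (π.ω : ℝ) := by
    have := π.p_pos
    have : 0 < π.ω := by unfold Param.ω; omega
    exact_mod_cast this
  refine ⟨⌊(2 * π.P * c + 1) / 2⌋, ?_, ?_, ?_⟩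
  all_goals
    set n := ⌊(2 * π.P * c + 1) / 2⌋ with hn
    have h1 : (n : ℝ) ≤ (2 * π.P * c + 1) / 2 := Int.floor_le _
    have h2 : (2 * π.P * c + 1) / 2 < n + 1 := Int.lt_floor_add_one _
    have hP : (π.ω : ℝ) * π.P = 2 * π.p := by
      unfold Param.P; field_simp
  · have : -(π.ω : ℝ) ≤ 2 * (2 * π.p * c - π.ω * n) := by
      have := mul_le_mul_of_nonneg_left h1 hω.le
      linear_combination 2 * this + 2 * (c : ℝ) * hP
    exact_mod_cast this
  · have : 2 * (2 * π.p * c - π.ω * n) < (π.ω : ℝ) := by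
      have := mul_lt_mul_of_pos_left h2 hω
      linear_combination 2 * this - 2 * (c : ℝ) * hP
    exact_mod_cast this
  · unfold Param.cap nrm
    rw [← hn, ← abs_of_pos hω, ← abs_mul]
    push_cast
    rw [← abs_two (α := ℝ), ← abs_mul, abs_two]
    congr 1
    linear_combination 2 * (c : ℝ) * hP

lemma cap_iff (π : Param) (c : ℤ) (m : ℕ) (hm : 2 * m < π.ω) :
    π.cap c = ((2 * m : ℕ) : ℝ) ↔
      ((π.ω : ℤ) ∣ 2 * π.p * c - m ∨ (π.ω : ℤ) ∣ 2 * π.p * c + m) := by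
  obtain ⟨n, h1, h2, h3⟩ := cap_form π c
  have hm' : 2 * (m : ℤ) < π.ω := by exact_mod_cast hm
  rw [h3]
  have e : ((2 * |2 * (π.p : ℤ) * c - π.ω * n| : ℤ) : ℝ) = ((2 * m : ℕ) : ℝ) ↔
      |2 * (π.p : ℤ) * c - π.ω * n| = m := by
    rw [← Int.cast_natCast (R := ℝ), Int.cast_inj]
    push_cast
    omega
  rw [e]
  generalize 2 * (π.p : ℤ) * c = X at *
  generalize (π.ω : ℤ) = w at *
  constructor
  · intro h
    rcases abs_eq (by positivity) |>.1 h with h | h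
    · exact Or.inl ⟨n, by linarith⟩
    · exact Or.inr ⟨n, by linarith⟩
  · have key : ∀ t : ℤ, -w < w * (t - n) → w * (t - n) < w → t = n := by
      intro t a b
      have hw : 0 < w := by omega
      have : t - n < 1 := by nlinarith
      have : -1 < t - n := by nlinarith
      omega
    rintro (⟨t, ht⟩ | ⟨t, ht⟩)
    · have := key t (by rw [mul_sub, ← ht]; omega) (by rw [mul_sub, ← ht]; omega)
      subst this
      rw [show X - w * t = m by linarith]; simp
    · by_cases hb : w * (t - n) = w
      · have : X - w * n = w - m := by linarith
        omega
      have := key t (by rw [mul_sub, ← ht]; omega) (by rw [mul_sub, ← ht]; omega)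
      subst this
      rw [show X - w * t = -m by linarith]; simp

lemma count_aux (π : Param) (a : ℤ) (m : ℕ) (hm : 2 * m < π.ω) :
    Set.ncard {c : ℤ | ((π.ω : ℤ) * a ≤ c ∧ c ≤ (π.ω : ℤ) * a + π.ω) ∧
        π.cap c = ((2 * m : ℕ) : ℝ)} = 2 := by
  have hodd : Odd π.ω := by
    have h := π.even_pq
    have hc := π.coprime
    unfold Param.ω
    rcases Nat.even_or_odd π.p with hp | hp <;> rcases Nat.even_or_odd π.q with hq | hq
    · have := Nat.dvd_gcd hp.two_dvd hq.two_dvd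
      rw [hc] at this; omega
    · exact hp.add_odd hq
    · exact hp.add_even hq
    · exact absurd h (Nat.not_even_iff_odd.2 (hp.mul hq))
  have hcop : Nat.Coprime (2 * π.p) π.ω := by
    apply Nat.Coprime.mul_left
    · exact (Nat.coprime_two_left).2 hodd
    · unfold Param.ω; simpa using π.coprime
  have hcop' : IsCoprime ((2 * π.p : ℕ) : ℤ) (π.ω : ℤ) := Nat.isCoprime_iff_coprime.2 hcop
  obtain ⟨u, v, huv⟩ := hcop'
  have hm' : 2 * (m : ℤ) < π.ω := by exact_mod_cast hm
  have hoddZ : Odd (π.ω : ℤ) := by exact_mod_cast hodd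
  simp_rw [cap_iff π _ m hm]
  push_cast at huv
  generalize (π.ω : ℤ) = w at *
  generalize 2 * (π.p : ℤ) = g at *
  have hw : 0 < w := by omega
  have hdiv : ∀ c s : ℤ, w ∣ g * c - s ↔ w ∣ c - u * s := by
    intro c s
    constructor
    · rintro ⟨t, ht⟩
      exact ⟨u * t + v * c, by linear_combination u * ht - c * huv⟩
    · rintro ⟨t, ht⟩
      exact ⟨g * t - v * s, by linear_combination g * ht + s * huv⟩
  set r := (u * m) % w with hr
  have hr0 : 0 ≤ r := Int.emod_nonneg _ hw.ne'
  have hrw : r < w := Int.emod_lt_of_pos _ hw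
  have hdm : w * (u * m / w) + r = u * m := Int.mul_ediv_add_emod _ _
  have e1 : ∀ c : ℤ, w ∣ g * c - m ↔ w ∣ c - r := by
    intro c
    rw [hdiv]
    constructor
    · rintro ⟨t, ht⟩; exact ⟨t + u * m / w, by linear_combination ht - hdm⟩
    · rintro ⟨t, ht⟩; exact ⟨t - u * m / w, by linear_combination ht + hdm⟩
  have e2 : ∀ c : ℤ, w ∣ g * c + m ↔ w ∣ c + r := by
    intro c
    have := e1 (-c)
    rw [← dvd_neg, ← dvd_neg (b := -c - r)] at this
    rwa [show -(g * -c - m) = g * c + m by ring, show -(-c - r) = c + r by ring] at this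
  simp_rw [e1, e2]
  have hr2 : r ≠ 0 ∨ (r = 0 ∧ m = 0) := by
    by_cases h : r = 0
    · right
      refine ⟨h, ?_⟩
      have h0 := (e1 0).2 (by simp [h])
      simp only [mul_zero, zero_sub, dvd_neg] at h0
      have := Int.eq_zero_of_dvd_of_nonneg_of_lt (by omega) (by omega) h0
      exact_mod_cast this
    · exact Or.inl h
  -- the unique multiples in range
  have key : ∀ x : ℤ, -w < w * x → w * x < w → x = 0 := by
    intro t a b
    have : t < 1 := by nlinarith
    have : -1 < t := by nlinarith
    omega
  rw [Set.ncard_eq_two]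
  rcases hr2 with h | ⟨h, -⟩
  · refine ⟨w * a + r, w * a + w - r, ?_, ?_⟩
    · obtain ⟨b, hb⟩ := hoddZ; omega
    · ext c
      simp only [Set.mem_ofPred_eq, Set.mem_insert_iff, Set.mem_singleton_iff]
      constructor
      · rintro ⟨⟨h1, h2⟩, ⟨t, ht⟩ | ⟨t, ht⟩⟩
        · left
          have := key (t - a) (by rw [mul_sub]; omega) (by rw [mul_sub]; omega)
          have : t = a := by omega
          subst this; omega
        · right
          have := key (t - a - 1) (by rw [mul_sub, mul_sub]; omega) (by rw [mul_sub, mul_sub]; omega)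
          have : t = a + 1 := by omega
          subst this; linarith
      · rintro (rfl | rfl)
        · exact ⟨by omega, Or.inl ⟨a, by ring⟩⟩
        · exact ⟨by omega, Or.inr ⟨a + 1, by ring⟩⟩
  · refine ⟨w * a, w * a + w, by omega, ?_⟩
    ext c
    simp only [Set.mem_ofPred_eq, Set.mem_insert_iff, Set.mem_singleton_iff, h, sub_zero, add_zero,
      or_self]
    constructor
    · rintro ⟨⟨h1, h2⟩, ⟨t, ht⟩⟩
      by_cases hc : c = w * a + w
      · exact Or.inr hc
      left
      have := key (t - a) (by rw [mul_sub]; omega) (by rw [mul_sub]; omega)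
      have : t = a := by omega
      subst this; omega
    · rintro (rfl | rfl)
      · exact ⟨by omega, ⟨a, by ring⟩⟩
      · exact ⟨by omega, ⟨a + 1, by ring⟩⟩

/-- For every block `B` (indexed by `(i,j)`) and every even `k` with `0 ≤ k ≤ ω - 1`, exactly
`2` horizontal lines of `𝓗` of capacity `k` intersect `B`, and exactly `2` vertical lines of
`𝓥` of capacity `k` intersect `B`.  (A horizontal line `y = c` meets `B` iff
`ωj ≤ c ≤ ωj + ω`; a vertical line `x = c` meets `B` iff `ω²i ≤ c ≤ ω²i + ω`.) -/
theorem two_lines_of_each_capacity (π : Param) (i j : ℤ) (k : ℕ)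
    (hk : Even k) (hk' : k ≤ π.ω - 1) :
    Set.ncard {c : ℤ | ((π.ω : ℝ) * j ≤ (c : ℝ) ∧ (c : ℝ) ≤ (π.ω : ℝ) * j + π.ω) ∧
        π.cap c = k} = 2 ∧
    Set.ncard {c : ℤ | ((π.ω : ℝ) ^ 2 * i ≤ (c : ℝ) ∧ (c : ℝ) ≤ (π.ω : ℝ) ^ 2 * i + π.ω) ∧
        π.cap c = k} = 2 := by
  obtain ⟨m, rfl⟩ := hk.two_dvd
  have hpos : 0 < π.ω := by
    have := π.p_pos
    unfold Param.ω; omega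
  have hm : 2 * m < π.ω := by omega
  constructor
  · refine Eq.trans ?_ (count_aux π j m hm)
    congr 1
    ext c
    simp only [Set.mem_ofPred_eq]
    norm_cast
  · refine Eq.trans ?_ (count_aux π (π.ω * i) m hm)
    congr 1
    ext c
    simp only [Set.mem_ofPred_eq]
    rw [← mul_assoc, ← pow_two]
    norm_cast
end
end

section
/- Let B be a block and let L be a vertical line of capacity k intersecting B, where k > 0 is even. Then L ∩ B contains exactly k light points: exactly k/2 of type P and exactly k/2 of type Q. -/
noncomputable section
open scoped Classical

lemma nrm_bounds (x : ℝ) : -1 ≤ nrm x ∧ nrm x < 1 := by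
  unfold nrm
  have h1 := Int.floor_le ((x + 1) / 2)
  have h2 := Int.lt_floor_add_one ((x + 1) / 2)
  constructor <;> linarith

lemma nrm_unique (x v : ℝ) (m : ℤ) (h : x = v + 2 * m) (h1 : -1 ≤ v) (h2 : v < 1) :
    nrm x = v := by
  have : ⌊(x + 1) / 2⌋ = m := by
    rw [Int.floor_eq_iff]
    constructor <;> linarith
  unfold nrm
  rw [this]; linarith

lemma omega_facts (π : Param) : Odd (π.ω : ℤ) ∧ 0 < (π.ω : ℤ) ∧ IsCoprime (π.p : ℤ) (π.ω : ℤ) := by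
  have hp := π.p_pos
  have hco := π.coprime
  have hev := π.even_pq
  have hnot : ¬ (Even π.p ∧ Even π.q) := by
    rintro ⟨h1, h2⟩
    have := Nat.dvd_gcd h1.two_dvd h2.two_dvd
    rw [hco] at this
    omega
  refine ⟨?_, ?_, ?_⟩
  · have : Odd π.ω := by
      unfold Param.ω
      rw [Nat.even_mul] at hev
      rw [← Nat.not_even_iff_odd, Nat.even_add]
      tauto
    exact_mod_cast this
  · unfold Param.ω; omega
  · rw [Nat.isCoprime_iff_coprime]
    unfold Param.ω
    simpa using hco

/-- Integer numerator of `nrm (P n + 1)`. -/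
def rnum (π : Param) (n : ℤ) : ℤ := 2 * π.p * n + π.ω - 2 * π.ω * ⌊(π.P * n + 1 + 1) / 2⌋

lemma rnum_spec (π : Param) (n : ℤ) : nrm (π.P * n + 1) = (rnum π n : ℝ) / (π.ω : ℝ) := by
  have hw : (0 : ℝ) < (π.ω : ℝ) := by exact_mod_cast (omega_facts π).2.1
  unfold nrm rnum
  push_cast
  generalize ⌊(π.P * n + 1 + 1) / 2⌋ = f
  unfold Param.P
  field_simp

lemma light_iff (σ : ℤ) (hσ : σ = 1 ∨ σ = -1) (w : ℝ) (hw : 0 < w) (k : ℕ) (hk : 0 < k) (r : ℤ) :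
    lightPair ((σ : ℝ) * k / w) ((r : ℝ) / w) ↔ 0 < σ * r ∧ σ * r < k := by
  unfold lightPair
  have hk' : (0 : ℝ) < k := by exact_mod_cast hk
  have e : (σ : ℝ) * k / w * ((r : ℝ) / w) = (k / w ^ 2) * ((σ * r : ℤ) : ℝ) := by
    push_cast; field_simp
  have hpos : (0 : ℝ) < k / w ^ 2 := by positivity
  rw [e, gt_iff_lt, mul_pos_iff_of_pos_left hpos, Int.cast_pos, abs_div, abs_div, abs_of_pos hw,
    div_lt_div_iff_of_pos_right hw, abs_mul, abs_of_pos hk']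
  have hs : |(σ : ℝ)| = 1 := by rcases hσ with h | h <;> simp [h]
  rw [hs, one_mul]
  refine and_congr_right fun h => ?_
  have : |(r : ℝ)| = ((σ * r : ℤ) : ℝ) := by
    rw [← abs_of_pos (Int.cast_pos.mpr h : (0 : ℝ) < ((σ * r : ℤ) : ℝ))]
    push_cast
    rw [abs_mul, hs, one_mul]
  rw [this]
  exact_mod_cast Iff.rfl

lemma count_int (π : Param) (N : ℤ) (k : ℕ) (σ : ℤ) (hσ : σ = 1 ∨ σ = -1)
    (hk : Even k) (hkw : (k : ℤ) ≤ π.ω) :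
    ((Finset.Ico N (N + π.ω)).filter
      (fun n => 0 < σ * rnum π n ∧ σ * rnum π n < k)).card = k / 2 := by
  obtain ⟨hodd, hpos, hcop⟩ := omega_facts π
  obtain ⟨w, hw⟩ := hodd
  obtain ⟨l, rfl⟩ := hk
  have hrodd : ∀ n, ∃ u, σ * rnum π n = 2 * u + 1 := by
    intro n
    generalize hf : ⌊(π.P * n + 1 + 1) / 2⌋ = f
    unfold rnum
    rw [hf]
    rcases hσ with rfl | rfl
    · exact ⟨π.p * n + w - π.ω * f, by linear_combination hw⟩
    · exact ⟨-(π.p * n) - w - 1 + π.ω * f, by linear_combination -hw⟩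
  have hσ2 : σ * σ = 1 := by rcases hσ with rfl | rfl <;> norm_num
  have : (l + l) / 2 = l := by omega
  rw [this]
  conv_rhs => rw [← Finset.card_range l]
  refine Finset.card_bij (fun n _ => ((σ * rnum π n - 1) / 2).toNat) ?_ ?_ ?_
  · intro n hn
    simp only [Finset.mem_filter, Finset.mem_range] at *
    obtain ⟨u, hu⟩ := hrodd n
    push_cast at hn
    omega
  · intro n hn m hm h
    simp only [Finset.mem_filter, Finset.mem_Ico] at *
    obtain ⟨u, hu⟩ := hrodd n
    obtain ⟨v, hv⟩ := hrodd m
    have huv : σ * rnum π n = σ * rnum π m := by omega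
    have hr : rnum π n = rnum π m := by
      linear_combination σ * huv - (rnum π n - rnum π m) * hσ2
    unfold rnum at hr
    have hd : (π.ω : ℤ) ∣ π.p * (n - m) :=
      ⟨⌊(π.P * n + 1 + 1) / 2⌋ - ⌊(π.P * m + 1 + 1) / 2⌋, by linarith⟩
    have hd2 := hcop.symm.dvd_of_dvd_mul_left hd
    have := Int.eq_zero_of_abs_lt_dvd hd2 (by rw [abs_lt]; constructor <;> linarith)
    omega
  · intro t ht
    simp only [Finset.mem_range] at ht
    obtain ⟨a, b, hab⟩ := hcop
    obtain ⟨g, hg⟩ : ∃ g : ℤ, σ * (2 * t + 1) = 2 * g + π.ω := by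
      rcases hσ with rfl | rfl
      · exact ⟨t - w, by rw [hw]; ring⟩
      · exact ⟨-t - w - 1, by rw [hw]; ring⟩
    set n : ℤ := N + (a * g - N) % π.ω with hn
    have hmod := Int.emod_add_mul_ediv (a * g - N) π.ω
    have h0 := Int.emod_nonneg (a * g - N) hpos.ne'
    have h1 := Int.emod_lt_of_pos (a * g - N) hpos
    have hwR : (0 : ℝ) < (π.ω : ℝ) := by exact_mod_cast hpos
    have hpn : ∃ m : ℤ, (2 * π.p * n + π.ω : ℤ) = σ * (2 * t + 1) + 2 * π.ω * m := by
      refine ⟨-(b * g) - π.p * ((a * g - N) / π.ω), ?_⟩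
      rw [hg]
      have : n = a * g - π.ω * ((a * g - N) / π.ω) := by linarith
      rw [this]
      linear_combination 2 * g * hab
    obtain ⟨m, hm⟩ := hpn
    have hmR : (2 * π.p * n + π.ω : ℝ) = σ * (2 * t + 1) + 2 * π.ω * m := by exact_mod_cast hm
    have hb : -(π.ω : ℤ) ≤ σ * (2 * t + 1) ∧ σ * (2 * t + 1) < π.ω := by
      push_cast at hkw
      rcases hσ with rfl | rfl <;> constructor <;> omega
    have hbR : -(π.ω : ℝ) ≤ σ * (2 * t + 1) ∧ (σ : ℝ) * (2 * t + 1) < π.ω := by exact_mod_cast hb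
    have hnr := nrm_unique (π.P * n + 1) ((σ : ℝ) * (2 * t + 1) / π.ω) m
      (by unfold Param.P; field_simp; linarith)
      (by rw [le_div_iff₀ hwR]; linarith)
      (by rw [div_lt_one hwR]; linarith)
    rw [rnum_spec, div_left_inj' hwR.ne'] at hnr
    have hr : rnum π n = σ * (2 * t + 1) := by exact_mod_cast hnr
    have hr2 : σ * rnum π n = 2 * t + 1 := by rw [hr, ← mul_assoc, hσ2, one_mul]
    refine ⟨n, ?_, ?_⟩
    · simp only [Finset.mem_filter, Finset.mem_Ico]
      rw [hr2]
      push_cast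
      refine ⟨⟨by omega, by omega⟩, by omega, by omega⟩
    · simp only [hr2]
      omega

lemma count_real (π : Param) (j : ℤ) (k : ℕ) (s a : ℝ) (hs : ∀ n : ℤ, s ≠ n)
    (hk : Even k) (hk0 : 0 < k) (hkw : (k : ℤ) ≤ π.ω) (ha : π.ω * |a| = k) :
    {y : ℝ | y ∈ Set.Icc ((π.ω : ℝ) * j) ((π.ω : ℝ) * j + π.ω) ∧
      ∃ n : ℤ, y + s = n ∧ lightPair a (nrm (π.P * n + 1))}.ncard = k / 2 := by
  obtain ⟨-, hpos, -⟩ := omega_facts π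
  have hwR : (0 : ℝ) < (π.ω : ℝ) := by exact_mod_cast hpos
  obtain ⟨σ, hσ, hσa⟩ : ∃ σ : ℤ, (σ = 1 ∨ σ = -1) ∧ a = (σ : ℝ) * k / π.ω := by
    rcases abs_cases a with ⟨h, _⟩ | ⟨h, _⟩
    · exact ⟨1, Or.inl rfl, by rw [← ha, h]; push_cast; field_simp⟩
    · exact ⟨-1, Or.inr rfl, by rw [← ha, h]; push_cast; field_simp⟩
  set N : ℤ := π.ω * j + ⌊s⌋ + 1 with hN
  rw [← count_int π N k σ hσ hk hkw, ← Set.ncard_coe_finset]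
  have himg : {y : ℝ | y ∈ Set.Icc ((π.ω : ℝ) * j) ((π.ω : ℝ) * j + π.ω) ∧
      ∃ n : ℤ, y + s = n ∧ lightPair a (nrm (π.P * n + 1))} =
      (fun n : ℤ => (n : ℝ) - s) '' (((Finset.Ico N (N + π.ω)).filter
      (fun n => 0 < σ * rnum π n ∧ σ * rnum π n < k) : Finset ℤ) : Set ℤ) := by
    have hfl := Int.floor_le s
    have hfu := Int.lt_floor_add_one s
    have hfl' : (⌊s⌋ : ℝ) < s := lt_of_le_of_ne hfl (fun h => hs _ h.symm)
    ext y
    simp only [Set.mem_ofPred_eq, Set.mem_Icc, Set.mem_image, Finset.coe_filter, Finset.mem_Ico]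
    constructor
    · rintro ⟨⟨h1, h2⟩, n, hn, hl⟩
      rw [rnum_spec, hσa, light_iff σ hσ _ hwR k hk0] at hl
      refine ⟨n, ⟨⟨?_, ?_⟩, hl⟩, by linarith⟩
      · have : ((π.ω * j + ⌊s⌋ : ℤ) : ℝ) < n := by push_cast; linarith
        have := Int.cast_lt.mp this
        omega
      · have : (n : ℝ) < ((N + π.ω : ℤ) : ℝ) := by rw [hN]; push_cast; linarith
        exact Int.cast_lt.mp this
    · rintro ⟨n, ⟨⟨h1, h2⟩, hl⟩, rfl⟩
      have h1' : (N : ℝ) ≤ n := by exact_mod_cast h1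
      have h2' : n ≤ N + π.ω - 1 := by omega
      have h2'' : (n : ℝ) ≤ ((N + π.ω - 1 : ℤ) : ℝ) := by exact_mod_cast h2'
      rw [hN] at h1' h2''
      push_cast at h1' h2''
      refine ⟨⟨by linarith, by linarith⟩, n, by ring, ?_⟩
      rw [rnum_spec, hσa, light_iff σ hσ _ hwR k hk0]
      exact hl
  rw [himg, Set.ncard_image_of_injective]
  intro m n h
  simpa using h

lemma not_int (π : Param) (c : ℤ) (k : ℕ) (hkpos : 0 < k) (hcap : π.cap c = k) (m : ℤ) :
    2 * (π.P * c) ≠ m := by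
  obtain ⟨hodd, hpos, hcop⟩ := omega_facts π
  have hwR : (0 : ℝ) < (π.ω : ℝ) := by exact_mod_cast hpos
  intro h
  have h4 : (4 * π.p * c : ℤ) = π.ω * m := by
    have : (4 * π.p * c : ℝ) = π.ω * m := by
      rw [← h]; unfold Param.P; field_simp; ring
    exact_mod_cast this
  have hc2 : IsCoprime (2 : ℤ) (π.ω : ℤ) := by
    obtain ⟨w, hw⟩ := hodd
    exact ⟨-w, 1, by rw [hw]; ring⟩
  have hc4 : IsCoprime (2 * 2 * π.p : ℤ) (π.ω : ℤ) := (hc2.mul_left hc2).mul_left hcop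
  obtain ⟨d, hd⟩ : (π.ω : ℤ) ∣ c :=
    hc4.symm.dvd_of_dvd_mul_left ⟨m, by linarith⟩
  have hz : nrm (2 * π.P * c) = 0 := by
    apply nrm_unique _ _ (2 * π.p * d) _ (by norm_num) (by norm_num)
    rw [hd]; unfold Param.P; push_cast; field_simp; norm_num
  unfold Param.cap at hcap
  rw [hz] at hcap
  have hk0 : (k : ℝ) = 0 := by rw [← hcap]; simp
  exact hkpos.ne' (by exact_mod_cast hk0)

/-- Let `B` be the block indexed by `(i,j)` and let `L` be the vertical line `x = c`, of
capacity `k` with `k > 0` even, intersecting `B`.  Then `L ∩ B` contains exactly `k` light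
points: exactly `k/2` of type `P` and exactly `k/2` of type `Q`. -/
theorem vertical_line_light_count (π : Param) (i j : ℤ) (c : ℤ) (k : ℕ)
    (hk : Even k) (hkpos : 0 < k) (hcap : π.cap c = k)
    (hc : (π.ω : ℝ) ^ 2 * i ≤ (c : ℝ) ∧ (c : ℝ) ≤ (π.ω : ℝ) ^ 2 * i + π.ω) :
    Set.ncard {y : ℝ | y ∈ Set.Icc ((π.ω : ℝ) * j) ((π.ω : ℝ) * j + π.ω) ∧
        π.lightVP ((c : ℝ), y)} = k / 2 ∧
    Set.ncard {y : ℝ | y ∈ Set.Icc ((π.ω : ℝ) * j) ((π.ω : ℝ) * j + π.ω) ∧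
        π.lightVQ ((c : ℝ), y)} = k / 2 ∧
    Set.ncard {y : ℝ | y ∈ Set.Icc ((π.ω : ℝ) * j) ((π.ω : ℝ) * j + π.ω) ∧
        (π.lightVP ((c : ℝ), y) ∨ π.lightVQ ((c : ℝ), y))} = k := by
  obtain ⟨hodd, hpos, hcop⟩ := omega_facts π
  have hwR : (0 : ℝ) < (π.ω : ℝ) := by exact_mod_cast hpos
  have hni := not_int π c k hkpos hcap
  have hPQ : π.P + π.Q = 2 := by
    have : (π.ω : ℝ) = π.p + π.q := by unfold Param.ω; push_cast; ring
    unfold Param.P Param.Q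
    field_simp
    linarith
  have hQ : π.Q = 2 - π.P := by linarith
  have hsP : ∀ n : ℤ, π.P * c ≠ n := by
    intro n h
    apply hni (2 * n)
    rw [h]; push_cast; ring
  have hsQ : ∀ n : ℤ, π.Q * c ≠ n := by
    intro n h
    apply hni (2 * (2 * c - n))
    push_cast; rw [← h, hQ]; ring
  have hkw : (k : ℤ) ≤ π.ω := by
    have hb := nrm_bounds (2 * π.P * c)
    have habs : |nrm (2 * π.P * c)| ≤ 1 := abs_le.mpr ⟨hb.1, hb.2.le⟩
    have : (k : ℝ) ≤ π.ω := by
      rw [← hcap]; unfold Param.cap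
      nlinarith
    exact_mod_cast this
  have eP : ∀ y : ℝ, π.lightVP ((c : ℝ), y) ↔
      ∃ n : ℤ, y + π.P * c = n ∧ lightPair (nrm (2 * π.P * c)) (nrm (π.P * n + 1)) := by
    intro y
    have key : ∀ n : ℤ, y + π.P * c = n →
        π.P * y + π.P ^ 2 * c + 1 = π.P * n + 1 := by
      intro n hn; rw [← hn]; ring
    unfold Param.lightVP onV Param.onP Param.FV Param.FP
    constructor
    · rintro ⟨-, ⟨n, hn⟩, hl⟩
      refine ⟨n, hn, ?_⟩
      rw [← key n hn]; exact hl
    · rintro ⟨n, hn, hl⟩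
      refine ⟨⟨c, rfl⟩, ⟨n, hn⟩, ?_⟩
      rw [← key n hn] at hl; exact hl
  have eQ : ∀ y : ℝ, π.lightVQ ((c : ℝ), y) ↔
      ∃ n : ℤ, y + π.Q * c = n ∧ lightPair (nrm (2 * π.P * c)) (nrm (π.P * n + 1)) := by
    intro y
    have key : ∀ n : ℤ, y + π.Q * c = n →
        π.P * y + π.P * π.Q * c + 1 = π.P * n + 1 := by
      intro n hn; rw [← hn]; ring
    unfold Param.lightVQ onV Param.onQ Param.FV Param.FQ
    constructor
    · rintro ⟨-, ⟨n, hn⟩, hl⟩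
      refine ⟨n, hn, ?_⟩
      rw [← key n hn]; exact hl
    · rintro ⟨n, hn, hl⟩
      refine ⟨⟨c, rfl⟩, ⟨n, hn⟩, ?_⟩
      rw [← key n hn] at hl; exact hl
  have c1 := count_real π j k _ _ hsP hk hkpos hkw hcap
  have c2 := count_real π j k _ _ hsQ hk hkpos hkw hcap
  simp only [← eP] at c1
  simp only [← eQ] at c2
  have hk2 : 0 < k / 2 := by obtain ⟨l, rfl⟩ := hk; omega
  refine ⟨c1, c2, ?_⟩
  have hun : {y : ℝ | y ∈ Set.Icc ((π.ω : ℝ) * j) ((π.ω : ℝ) * j + π.ω) ∧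
        (π.lightVP ((c : ℝ), y) ∨ π.lightVQ ((c : ℝ), y))} =
      {y : ℝ | y ∈ Set.Icc ((π.ω : ℝ) * j) ((π.ω : ℝ) * j + π.ω) ∧ π.lightVP ((c : ℝ), y)} ∪
      {y : ℝ | y ∈ Set.Icc ((π.ω : ℝ) * j) ((π.ω : ℝ) * j + π.ω) ∧ π.lightVQ ((c : ℝ), y)} := by
    ext y
    simp only [Set.mem_ofPred_eq, Set.mem_union]
    tauto
  rw [hun, Set.ncard_union_eq ?_ (Set.finite_of_ncard_pos (by rw [c1]; exact hk2))
    (Set.finite_of_ncard_pos (by rw [c2]; exact hk2)), c1, c2]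
  · obtain ⟨l, rfl⟩ := hk; omega
  · rw [Set.disjoint_left]
    rintro y ⟨-, h1⟩ ⟨-, h2⟩
    obtain ⟨n, hn, -⟩ := (eP y).mp h1
    obtain ⟨m, hm, -⟩ := (eQ y).mp h2
    apply hni (2 * c - m + n)
    push_cast
    rw [← hn, ← hm, hQ]; ring
end
end

section
/- Let B be a block and let L be a horizontal line of capacity k intersecting B, where k ≥ 0 is even. Then L ∩ B carries exactly k light points, counted with the double-counting convention. -/
noncomputable section
open scoped Classical

/-- Integer reformulation of lightness of the slanted line of intercept `n`. -/
def LM (p w A n : ℤ) : Prop := ∃ B : ℤ, 2 * w ∣ 2 * p * n + w - B ∧ 0 < A * B ∧ |B| < |A|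

theorem LM_shift (p w A n r : ℤ) : LM p w A (n + w * r) ↔ LM p w A n := by
  have e : 2 * p * (n + w * r) + w = 2 * p * n + w + 2 * w * (p * r) := by ring
  unfold LM
  rw [e]
  refine exists_congr fun B => and_congr_left fun _ => ?_
  rw [show 2 * p * n + w + 2 * w * (p * r) - B = (2 * p * n + w - B) + 2 * w * (p * r) by ring]
  exact dvd_add_left (dvd_mul_right _ _)

theorem LM_reflect_aux (p w A c m t : ℤ) (hA : A = 4 * p * c - 2 * w * m)
    (h : LM p w A (c + t)) : LM p w A (c - t) := by
  obtain ⟨B, ⟨d, hd⟩, h1, h2⟩ := h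
  refine ⟨A - B, ⟨m + 1 - d, ?_⟩, ?_, ?_⟩
  · rw [hA]; linear_combination -hd
  · rcases lt_trichotomy A 0 with h | h | h
    · have hB : B < 0 := by nlinarith
      rw [abs_of_neg h, abs_of_neg hB] at h2
      nlinarith
    · subst h; simp at h1
    · have hB : 0 < B := by nlinarith
      rw [abs_of_pos h, abs_of_pos hB] at h2
      nlinarith
  · rcases lt_trichotomy A 0 with h | h | h
    · have hB : B < 0 := by nlinarith
      rw [abs_of_neg h, abs_of_neg hB] at h2
      rw [abs_of_neg h, abs_of_neg (by omega)]; omega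
    · subst h; simp at h1
    · have hB : 0 < B := by nlinarith
      rw [abs_of_pos h, abs_of_pos hB] at h2
      rw [abs_of_pos h, abs_of_pos (by omega)]; omega

theorem LM_reflect (p w A c m t : ℤ) (hA : A = 4 * p * c - 2 * w * m) :
    LM p w A (c + t) ↔ LM p w A (c - t) := by
  constructor
  · exact LM_reflect_aux p w A c m t hA
  · intro h
    have := LM_reflect_aux p w A c m (-t) hA (by simpa [sub_eq_add_neg] using h)
    simpa using this

theorem card_two_periods (a v r : ℤ) (hr : 0 < r) :
    (Finset.filter (fun x => x ≡ v [ZMOD r]) (Finset.Ico a (a + 2 * r))).card = 2 := by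
  have h := Int.Ico_filter_modEq_card a (a + 2 * r) hr v
  have hr' : (r : ℚ) ≠ 0 := by exact_mod_cast hr.ne'
  have e : (((a + 2 * r : ℤ) : ℚ) - v) / r = ((a : ℚ) - v) / r + (2 : ℤ) := by
    push_cast; field_simp; ring
  rw [e, Int.ceil_add_intCast] at h
  have : ((Finset.filter (fun x => x ≡ v [ZMOD r]) (Finset.Ico a (a + 2 * r))).card : ℤ) = 2 := by
    convert h using 1
    simp
  exact_mod_cast this

theorem LM_count (p w A a u d s : ℤ) (l : ℕ) (w' : ℤ) (hw : w = 2 * w' + 1) (hpos : 0 < w)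
    (hu : p * u = 1 + w * d) (hs : s = 1 ∨ s = -1) (hA : A = s * (2 * l)) (hl : 2 * (l : ℤ) ≤ w) :
    (Finset.filter (fun n => LM p w A n) (Finset.Ico a (a + 2 * w))).card = 2 * l := by
  have key : ∃ H : ℕ → ℤ, ∀ j, 2 * H j + w = s * (2 * j + 1) := by
    rcases hs with rfl | rfl
    · exact ⟨fun j => j - w', fun j => by rw [hw]; ring⟩
    · exact ⟨fun j => -j - 1 - w', fun j => by rw [hw]; ring⟩
  obtain ⟨H, hH⟩ := key
  have equ : ∀ n h : ℤ, n ≡ u * h [ZMOD w] ↔ w ∣ p * n - h := by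
    intro n h
    rw [Int.modEq_iff_dvd]
    constructor
    · rintro ⟨e, he⟩
      exact ⟨d * h - p * e, by linear_combination h * hu - p * he⟩
    · rintro ⟨e, he⟩
      exact ⟨d * n - u * e, by linear_combination n * hu - u * he⟩
  have main : ∀ n, LM p w A n ↔ ∃ j ∈ Finset.range l, n ≡ u * H j [ZMOD w] := by
    intro n
    constructor
    · rintro ⟨B, ⟨e, he⟩, h1, h2⟩
      have hj : ∃ j : ℕ, j < l ∧ B = s * (2 * j + 1) := by
        have hodd : B = 2 * (p * n + w' - w * e) + 1 := by rw [hw] at he ⊢; linarith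
        generalize p * n + w' - w * e = b at hodd
        rcases hs with rfl | rfl
        · have hA0 : 0 ≤ A := by omega
          have hB : 0 < B := by nlinarith
          rw [abs_of_pos hB, abs_of_nonneg hA0] at h2
          exact ⟨b.toNat, by omega, by omega⟩
        · have hA0 : A ≤ 0 := by omega
          have hB : B < 0 := by nlinarith
          rw [abs_of_neg hB, abs_of_nonpos hA0] at h2
          exact ⟨(-b - 1).toNat, by omega, by omega⟩
      obtain ⟨j, hj, hB⟩ := hj
      refine ⟨j, Finset.mem_range.2 hj, (equ _ _).2 ⟨e, ?_⟩⟩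
      have := hH j
      have h2 : 2 * (p * n - H j) = 2 * (w * e) := by linarith
      linarith
    · rintro ⟨j, hj, h⟩
      rw [Finset.mem_range] at hj
      obtain ⟨e, he⟩ := (equ _ _).1 h
      refine ⟨s * (2 * j + 1), ⟨e, ?_⟩, ?_, ?_⟩
      · rw [← hH j]; linear_combination 2 * he
      · have h0 : 0 < (2 * (l : ℤ)) * (2 * j + 1) := by
          apply mul_pos <;> omega
        rw [hA]
        rcases hs with rfl | rfl <;> linarith
      · rw [hA, abs_mul, abs_mul]
        have : |s| = 1 := by rcases hs with rfl | rfl <;> simp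
        rw [this, abs_of_nonneg (by omega), abs_of_nonneg (by omega)]
        omega
  have e1 : Finset.filter (fun n => LM p w A n) (Finset.Ico a (a + 2 * w)) =
      (Finset.range l).biUnion fun j =>
        Finset.filter (fun n => n ≡ u * H j [ZMOD w]) (Finset.Ico a (a + 2 * w)) := by
    ext n
    simp only [Finset.mem_filter, Finset.mem_biUnion, main]
    tauto
  rw [e1, Finset.card_biUnion]
  · rw [Finset.sum_congr rfl (fun j _ => card_two_periods a (u * H j) w hpos)]
    simp [mul_comm]
  · intro j hj j' hj' hne
    rw [Finset.mem_coe, Finset.mem_range] at *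
    rw [Function.onFun, Finset.disjoint_left]
    intro n hn hn'
    rw [Finset.mem_filter] at hn hn'
    obtain ⟨e, he⟩ := (equ _ _).1 hn.2
    obtain ⟨f, hf⟩ := (equ _ _).1 hn'.2
    apply hne
    have h1 := hH j
    have h2 := hH j'
    have h3 : H j - H j' = w * (f - e) := by linear_combination hf - he
    have h4 : |H j - H j'| < w := by
      rw [abs_lt]
      rcases hs with rfl | rfl <;> constructor <;> omega
    have h5 : H j - H j' = 0 := Int.eq_zero_of_abs_lt_dvd ⟨_, h3⟩ h4
    rcases hs with rfl | rfl <;> omega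

theorem total_count (p q w A c m u d s : ℤ) (l : ℕ) (w' : ℤ) (hw : w = 2 * w' + 1) (hpos : 0 < w)
    (hp : 0 < p) (hq : 0 < q) (hpq : w = p + q) (hAm : A = 4 * p * c - 2 * w * m)
    (hu : p * u = 1 + w * d) (hs : s = 1 ∨ s = -1) (hA : A = s * (2 * l)) (hl : 2 * (l : ℤ) ≤ w) :
    (Finset.filter (fun t => LM p w A (c + t)) (Finset.Icc 0 (2 * p))).card +
    (Finset.filter (fun t => LM p w A (c + t)) (Finset.Ioo 0 (2 * q))).card = 2 * l := by
  rw [← LM_count p w A c u d s l w' hw hpos hu hs hA hl]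
  have e1 : (Finset.filter (fun t => LM p w A (c + t)) (Finset.Icc 0 (2 * p))).card =
      (Finset.filter (fun t => LM p w A t) (Finset.Icc c (c + 2 * p))).card := by
    apply Finset.card_bij (fun t _ => c + t)
    · intro t ht
      simp only [Finset.mem_filter, Finset.mem_Icc] at ht ⊢
      exact ⟨by omega, ht.2⟩
    · intro a _ b _ h; simpa using h
    · intro t ht
      simp only [Finset.mem_filter, Finset.mem_Icc] at ht ⊢
      exact ⟨t - c, ⟨by omega, by simpa using ht.2⟩, by ring⟩
  have e2 : (Finset.filter (fun t => LM p w A (c + t)) (Finset.Ioo 0 (2 * q))).card =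
      (Finset.filter (fun t => LM p w A t) (Finset.Ioo (c + 2 * p) (c + 2 * w))).card := by
    have sh : ∀ t, LM p w A (c + t) ↔ LM p w A (c + 2 * w - t) := by
      intro t
      rw [LM_reflect p w A c m t hAm, ← LM_shift p w A (c - t) 2]
      rw [show c - t + w * 2 = c + 2 * w - t by ring]
    apply Finset.card_bij (fun t _ => c + 2 * w - t)
    · intro t ht
      simp only [Finset.mem_filter, Finset.mem_Ioo] at ht ⊢
      exact ⟨by omega, (sh t).1 ht.2⟩
    · intro a _ b _ h; simpa using h
    · intro t ht
      simp only [Finset.mem_filter, Finset.mem_Ioo] at ht ⊢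
      refine ⟨c + 2 * w - t, ⟨by omega, (sh _).2 ?_⟩, by ring⟩
      rw [show c + 2 * w - (c + 2 * w - t) = t by ring]
      exact ht.2
  rw [e1, e2, ← Finset.card_union_of_disjoint]
  · congr 1
    ext t
    simp only [Finset.mem_union, Finset.mem_filter, Finset.mem_Ioo, Finset.mem_Icc, Finset.mem_Ico]
    rw [← or_and_right]
    exact and_congr_left fun _ => by omega
  · rw [Finset.disjoint_left]
    intro t ht ht'
    simp only [Finset.mem_filter, Finset.mem_Ioo, Finset.mem_Icc] at ht ht'
    omega

theorem light_iff_s3 (p w A n : ℤ) (a y : ℝ) (hpos : 0 < w) (ha : a = A / w) (hA : |A| ≤ w)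
    (hy : y = (2 * p * n + w : ℤ) / (w : ℝ)) : lightPair a (nrm y) ↔ LM p w A n := by
  have hw : (0 : ℝ) < w := by exact_mod_cast hpos
  have conv : ∀ B : ℤ, lightPair a (B / w) ↔ 0 < A * B ∧ |B| < |A| := by
    intro B
    unfold lightPair
    rw [ha, abs_div, abs_div, div_lt_div_iff_of_pos_right (by positivity), gt_iff_lt,
      div_mul_div_comm, div_pos_iff_of_pos_right (by positivity)]
    norm_cast
  constructor
  · intro h
    have e : nrm y = ((2 * p * n + w - 2 * w * ⌊(y + 1) / 2⌋ : ℤ) : ℝ) / w := by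
      unfold nrm
      conv_lhs => rw [show y - 2 * (⌊(y + 1) / 2⌋ : ℝ) = (y * w - 2 * w * ⌊(y + 1) / 2⌋) / w by
        field_simp]
      congr 1
      have : y * w = (2 * p * n + w : ℤ) := by rw [hy]; field_simp
      rw [this]; push_cast; ring
    rw [e, conv] at h
    exact ⟨_, ⟨⌊(y + 1) / 2⌋, by ring⟩, h⟩
  · rintro ⟨B, ⟨r, hr⟩, h⟩
    have hb : |B| < w := lt_of_lt_of_le h.2 hA
    rw [abs_lt] at hb
    have hb1 : (-w : ℝ) < B := by exact_mod_cast hb.1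
    have hb2 : (B : ℝ) < w := by exact_mod_cast hb.2
    have hy' : y = B / w + 2 * r := by
      rw [hy, show 2 * p * n + w = B + 2 * w * r by linarith]
      push_cast; field_simp
    have c1 : -1 < (B : ℝ) / w := by rw [lt_div_iff₀ hw]; linarith
    have c2 : (B : ℝ) / w < 1 := by rw [div_lt_iff₀ hw]; linarith
    have hf : ⌊(y + 1) / 2⌋ = r := by
      rw [Int.floor_eq_iff, hy']; constructor <;> linarith
    have : nrm y = B / w := by
      unfold nrm; rw [hf, hy']; ring
    rw [this, conv]
    exact h

set_option maxHeartbeats 2000000 in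
/-- Let `B` be the block indexed by `(i,j)` and let `L` be the horizontal line `y = c`, of
capacity `k` (`k ≥ 0` even), intersecting `B`.  Then `L ∩ B` carries exactly `k` light points,
counted with the double-counting convention: a light point lying simultaneously on a `𝓟` line
and a `𝓠` line which is the midpoint of a horizontal unit segment counts twice. -/
theorem horizontal_line_light_count (π : Param) (i j : ℤ) (c : ℤ) (k : ℕ)
    (hk : Even k) (hcap : π.cap c = k)
    (hc : (π.ω : ℝ) * j ≤ (c : ℝ) ∧ (c : ℝ) ≤ (π.ω : ℝ) * j + π.ω) :
    Set.ncard {x : ℝ | x ∈ Set.Icc ((π.ω : ℝ) ^ 2 * i) ((π.ω : ℝ) ^ 2 * i + π.ω) ∧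
        π.lightHP (x, (c : ℝ))} +
    Set.ncard {x : ℝ | x ∈ Set.Icc ((π.ω : ℝ) ^ 2 * i) ((π.ω : ℝ) ^ 2 * i + π.ω) ∧
        π.lightHQ (x, (c : ℝ)) ∧ (π.onP (x, (c : ℝ)) → ∃ m : ℤ, x = (m : ℝ) + 1 / 2)} = k := by
  obtain ⟨p, q, hp, hpq, hcop, heven⟩ := π
  have hcopw : IsCoprime (p : ℤ) ((p + q : ℕ) : ℤ) := by
    rw [Nat.isCoprime_iff_coprime]
    simpa using hcop
  have hoddw : Odd (p + q) := by
    rw [Nat.odd_add]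
    rcases Nat.even_or_odd p with h | h
    · have : ¬ Even q := fun h' => by
        have := Nat.dvd_gcd h.two_dvd h'.two_dvd
        rw [hcop] at this; omega
      simp only [← Nat.not_even_iff_odd, h, this, not_true_eq_false]
    · have : Even q := by
        rcases Nat.even_mul.1 heven with h' | h'
        · exact absurd h' (Nat.not_even_iff_odd.2 h)
        · exact h'
      simp only [h, this]
  obtain ⟨l, hl⟩ := hk
  obtain ⟨w', hw'⟩ := hoddw
  set W : ℤ := ((p + q : ℕ) : ℤ) with hW
  have hWpos : 0 < W := by omega
  have hwR : ((p + q : ℕ) : ℝ) = (W : ℝ) := by rw [hW]; norm_cast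
  have hWR : (0 : ℝ) < W := by exact_mod_cast hWpos
  have hpR : (0 : ℝ) < p := by exact_mod_cast hp
  have hqR : (0 : ℝ) < q := by exact_mod_cast (hp.trans hpq)
  have hWpq : (W : ℝ) = p + q := by rw [← hwR]; push_cast; ring
  simp only [Param.cap, Param.lightHP, Param.lightHQ, Param.FH, Param.FP, Param.FQ, Param.onP,
    Param.onQ, Param.P, Param.Q, Param.ω, hwR] at *
  set m : ℤ := ⌊(2 * (2 * (p : ℝ) / W) * c + 1) / 2⌋ with hm
  set A : ℤ := 4 * p * c - 2 * W * m with hAm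
  have ha : nrm (2 * (2 * (p : ℝ) / W) * c) = A / W := by
    unfold nrm
    rw [← hm, hAm]; push_cast; field_simp; ring
  have hAk : |A| = k := by
    rw [ha, abs_div, abs_of_pos hWR, mul_div_cancel₀ _ hWR.ne'] at hcap
    exact_mod_cast hcap
  have hAW : |A| ≤ W := by
    have h1 := Int.floor_le ((2 * (2 * (p : ℝ) / W) * c + 1) / 2)
    have h2 := Int.lt_floor_add_one ((2 * (2 * (p : ℝ) / W) * c + 1) / 2)
    rw [← hm] at h1 h2
    have e : (A : ℝ) / W = 2 * (2 * (p : ℝ) / W) * c - 2 * m := by rw [← ha, nrm]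
    have h3 : -1 ≤ (A : ℝ) / W := by linarith
    have h4 : (A : ℝ) / W ≤ 1 := by linarith
    rw [le_div_iff₀ hWR] at h3
    rw [div_le_iff₀ hWR] at h4
    rw [abs_le]
    constructor
    · have : ((-W : ℤ) : ℝ) ≤ A := by push_cast; linarith
      exact_mod_cast this
    · have : (A : ℝ) ≤ W := by linarith
      exact_mod_cast this
  obtain ⟨u, d, hud⟩ := hcopw
  obtain ⟨s, hs, hsA⟩ : ∃ s : ℤ, (s = 1 ∨ s = -1) ∧ A = s * (2 * l) := by
    rcases abs_choice A with h | h
    · exact ⟨1, Or.inl rfl, by omega⟩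
    · exact ⟨-1, Or.inr rfl, by omega⟩
  have tot := total_count p q W A c m u (-d) s l w' (by omega) hWpos (by omega) (by omega)
    (by rw [hW]; push_cast; ring) hAm (by linear_combination hud) hs hsA (by omega)
  have light : ∀ n : ℤ, lightPair (nrm (2 * (2 * (p : ℝ) / W) * c)) (nrm (2 * p / W * n + 1)) ↔
      LM p W A n := by
    intro n
    apply light_iff_s3 p W A n _ _ hWpos ha hAW
    push_cast; field_simp
  rw [show k = 2 * l by omega, ← tot]
  congr 1
  · rw [← Set.ncard_coe_finset]
    symm
    apply Set.ncard_congr (fun (t : ℤ) _ => (W : ℝ) ^ 2 * i + t * W / (2 * p))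
    · intro t ht
      simp only [Finset.coe_filter, Finset.mem_Icc, Set.mem_ofPred_eq] at ht
      obtain ⟨⟨h0, h1⟩, h2⟩ := ht
      have h0' : (0 : ℝ) ≤ t := by exact_mod_cast h0
      have h1' : (t : ℝ) ≤ 2 * p := by exact_mod_cast h1
      have hon : (c : ℝ) + 2 * p / W * ((W : ℝ) ^ 2 * i + t * W / (2 * p)) =
          ((c + t + W * (2 * p * i) : ℤ) : ℝ) := by
        push_cast; field_simp; ring
      refine ⟨⟨?_, ?_⟩, ⟨c, rfl⟩, ⟨_, hon⟩, ?_⟩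
      · have : 0 ≤ t * W / (2 * (p : ℝ)) := by positivity
        linarith
      · have : t * W / (2 * (p : ℝ)) ≤ W := by
          rw [div_le_iff₀ (by positivity)]; nlinarith
        linarith
      · rw [← LM_shift _ _ _ _ (2 * p * i), ← light, ← hon] at h2
        convert h2 using 2
        ring
    · intro a b _ _ h
      have : (a : ℝ) = b := by
        field_simp at h
        linarith
      exact_mod_cast this
    · rintro x ⟨⟨hx0, hx1⟩, -, ⟨n, hn⟩, hl⟩
      have hx : x = (n - c) * W / (2 * p) := by
        rw [← hn]; field_simp; ring
      refine ⟨n - c - W * (2 * p * i), ?_, ?_⟩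
      · simp only [Finset.coe_filter, Finset.mem_Icc, Set.mem_ofPred_eq]
        have ht : ((n - c - W * (2 * p * i) : ℤ) : ℝ) = (x - W ^ 2 * i) * (2 * p) / W := by
          rw [hx]; push_cast; field_simp
        refine ⟨⟨?_, ?_⟩, ?_⟩
        · have : (0 : ℝ) ≤ ((n - c - W * (2 * p * i) : ℤ) : ℝ) := by
            rw [ht]
            apply div_nonneg _ hWR.le
            apply mul_nonneg <;> linarith
          exact_mod_cast this
        · have : ((n - c - W * (2 * p * i) : ℤ) : ℝ) ≤ 2 * p := by
            rw [ht, div_le_iff₀ hWR]; nlinarith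
          exact_mod_cast this
        · rw [← LM_shift _ _ _ _ (2 * p * i),
            show c + (n - c - W * (2 * p * i)) + W * (2 * p * i) = n by ring, ← light, ← hn]
          convert hl using 2
          ring
      · rw [hx]; push_cast; field_simp; ring
  · rw [← Set.ncard_coe_finset]
    symm
    apply Set.ncard_congr (fun (t : ℤ) _ => (W : ℝ) ^ 2 * i + t * W / (2 * q))
    · intro t ht
      simp only [Finset.coe_filter, Finset.mem_Ioo, Set.mem_ofPred_eq] at ht
      obtain ⟨⟨h0, h1⟩, h2⟩ := ht
      have h0' : (0 : ℝ) ≤ t := by exact_mod_cast h0.le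
      have h1' : (t : ℝ) ≤ 2 * q := by exact_mod_cast h1.le
      have hon : (c : ℝ) + 2 * q / W * ((W : ℝ) ^ 2 * i + t * W / (2 * q)) =
          ((c + t + W * (2 * q * i) : ℤ) : ℝ) := by
        push_cast; field_simp; ring
      refine ⟨⟨?_, ?_⟩, ⟨⟨c, rfl⟩, ⟨_, hon⟩, ?_⟩, ?_⟩
      · have : 0 ≤ t * W / (2 * (q : ℝ)) := by positivity
        linarith
      · have : t * W / (2 * (q : ℝ)) ≤ W := by
          rw [div_le_iff₀ (by positivity)]; nlinarith
        linarith
      · rw [← LM_shift _ _ _ _ (2 * q * i), ← light, ← hon] at h2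
        convert h2 using 2
        ring
      · rintro ⟨n, hn⟩
        have h3 : (p * t : ℝ) = q * (n - c - W * (2 * p * i)) := by
          rw [← hn]; field_simp; ring
        have h4 : (p : ℤ) * t = q * (n - c - W * (2 * p * i)) := by exact_mod_cast h3
        have hdvd : (q : ℤ) ∣ t :=
          (Nat.isCoprime_iff_coprime.2 hcop.symm).dvd_of_dvd_mul_left ⟨_, h4⟩
        obtain ⟨r, hr⟩ := hdvd
        have hq0 : (0 : ℤ) < q := by omega
        have hr1 : r = 1 := by
          have : 0 < r := by nlinarith
          have : r < 2 := by nlinarith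
          omega
        refine ⟨W ^ 2 * i + w', ?_⟩
        have hWw : (W : ℝ) = 2 * w' + 1 := by exact_mod_cast (by omega : W = 2 * w' + 1)
        rw [hr, hr1]
        have : ((q * 1 : ℤ) : ℝ) * W / (2 * q) = W / 2 := by
          push_cast; field_simp
        rw [this]
        push_cast
        linarith
    · intro a b _ _ h
      have : (a : ℝ) = b := by
        field_simp at h
        linarith
      exact_mod_cast this
    · rintro x ⟨⟨hx0, hx1⟩, ⟨-, ⟨n, hn⟩, hl⟩, himp⟩
      have hx : x = (n - c) * W / (2 * q) := by
        rw [← hn]; field_simp; ring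
      -- integer abscissae on both families are excluded
      have hno : ∀ e : ℤ, x = W ^ 2 * i + W * e → False := by
        intro e he
        obtain ⟨M, hM⟩ := himp ⟨c + 2 * p * (W * i + e), by rw [he]; push_cast; field_simp⟩
        rw [he] at hM
        have : (2 * (W ^ 2 * i + W * e) : ℝ) = 2 * M + 1 := by linarith
        have : 2 * (W ^ 2 * i + W * e) = 2 * M + 1 := by exact_mod_cast this
        omega
      refine ⟨n - c - W * (2 * q * i), ?_, ?_⟩
      · simp only [Finset.coe_filter, Finset.mem_Ioo, Set.mem_ofPred_eq]
        have ht : ((n - c - W * (2 * q * i) : ℤ) : ℝ) = (x - W ^ 2 * i) * (2 * q) / W := by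
          rw [hx]; push_cast; field_simp
        have hx0' : (W : ℝ) ^ 2 * i < x :=
          lt_of_le_of_ne hx0 fun h => hno 0 (by push_cast; linarith)
        have hx1' : x < (W : ℝ) ^ 2 * i + W :=
          lt_of_le_of_ne hx1 fun h => hno 1 (by push_cast; linarith)
        refine ⟨⟨?_, ?_⟩, ?_⟩
        · have : (0 : ℝ) < ((n - c - W * (2 * q * i) : ℤ) : ℝ) := by
            rw [ht]
            apply div_pos _ hWR
            apply mul_pos <;> linarith
          exact_mod_cast this
        · have : ((n - c - W * (2 * q * i) : ℤ) : ℝ) < 2 * q := by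
            rw [ht, div_lt_iff₀ hWR]; nlinarith
          exact_mod_cast this
        · rw [← LM_shift _ _ _ _ (2 * q * i),
            show c + (n - c - W * (2 * q * i)) + W * (2 * q * i) = n by ring, ← light, ← hn]
          convert hl using 2
          ring
      · rw [hx]; push_cast; field_simp; ring
end
end

section
/- Every unit segment contains exactly 2 intersection points. Precisely: every vertical unit segment contains exactly one intersection point of type P and exactly one of type Q; and every horizontal unit segment contains exactly two intersection points, where a point lying simultaneously on a 𝓟 line and a 𝓠 line (necessarily the midpoint of the segment) is counted twice. -/
noncomputable section
open scoped Classical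

lemma ncard_vert (c : ℝ) (n : ℤ) :
    Set.ncard {y : ℝ | y ∈ Set.Ico (n : ℝ) ((n : ℝ) + 1) ∧ ∃ k : ℤ, y + c = (k : ℝ)} = 1 := by
  rw [Set.ncard_eq_one]
  refine ⟨(⌈(n : ℝ) + c⌉ : ℝ) - c, ?_⟩
  ext y
  simp only [Set.mem_setOf_eq, Set.mem_Ico, Set.mem_singleton_iff]
  have h1 := Int.le_ceil ((n : ℝ) + c)
  have h2 := Int.ceil_lt_add_one ((n : ℝ) + c)
  constructor
  · rintro ⟨⟨h3, h4⟩, k, hk⟩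
    have : ⌈(n : ℝ) + c⌉ = k := by
      rw [Int.ceil_eq_iff]
      constructor <;> linarith
    rw [this]
    linarith
  · rintro rfl
    exact ⟨⟨by linarith, by linarith⟩, _, by ring⟩

lemma ncard_scaled (c : ℝ) (hc : 0 < c) (s : Finset ℤ) :
    Set.ncard {x : ℝ | ∃ k ∈ s, c * x = (k : ℝ)} = s.card := by
  have : {x : ℝ | ∃ k ∈ s, c * x = (k : ℝ)} = (fun k : ℤ => (k : ℝ) / c) '' (s : Set ℤ) := by
    ext x
    simp only [Set.mem_setOf_eq, Set.mem_image, Finset.mem_coe]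
    constructor
    · rintro ⟨k, hk, h⟩
      exact ⟨k, hk, by rw [← h]; field_simp⟩
    · rintro ⟨k, hk, rfl⟩
      exact ⟨k, hk, by field_simp⟩
  rw [this, Set.ncard_image_of_injective, Set.ncard_coe_finset]
  intro a b hab
  have h : (a : ℝ) / c = (b : ℝ) / c := hab
  field_simp at h
  exact_mod_cast h

lemma horiz_count (P Q : ℝ) (hP : 0 < P) (hP1 : P ≤ 1) (hQ : 0 < Q) (hPQ : P + Q = 2)
    (m n : ℤ) :
    Set.ncard {x : ℝ | x ∈ Set.Icc (m : ℝ) ((m : ℝ) + 1) ∧ ∃ k : ℤ, (n : ℝ) + P * x = k} +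
    Set.ncard {x : ℝ | x ∈ Set.Icc (m : ℝ) ((m : ℝ) + 1) ∧ (∃ k : ℤ, (n : ℝ) + Q * x = k) ∧
      ((∃ k : ℤ, (n : ℝ) + P * x = k) → x = (m : ℝ) + 1 / 2)} = 2 := by
  have e1 : {x : ℝ | x ∈ Set.Icc (m : ℝ) ((m : ℝ) + 1) ∧ ∃ k : ℤ, (n : ℝ) + P * x = k} =
      {x : ℝ | ∃ k ∈ Finset.Icc ⌈P * m⌉ ⌊P * (m + 1)⌋, P * x = (k : ℝ)} := by
    ext x
    simp only [Set.mem_setOf_eq, Set.mem_Icc, Finset.mem_Icc, Int.ceil_le, Int.le_floor]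
    constructor
    · rintro ⟨⟨h1, h2⟩, k, hk⟩
      have hk' : P * x = ((k - n : ℤ) : ℝ) := by push_cast; linarith
      refine ⟨k - n, ?_, hk'⟩
      rw [← hk']
      exact ⟨by gcongr, by gcongr⟩
    · rintro ⟨k, ⟨h1, h2⟩, hk⟩
      rw [← hk] at h1 h2
      exact ⟨⟨le_of_mul_le_mul_left h1 hP, le_of_mul_le_mul_left h2 hP⟩, n + k,
        by push_cast; linarith⟩
  have e2 : {x : ℝ | x ∈ Set.Icc (m : ℝ) ((m : ℝ) + 1) ∧ (∃ k : ℤ, (n : ℝ) + Q * x = k) ∧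
      ((∃ k : ℤ, (n : ℝ) + P * x = k) → x = (m : ℝ) + 1 / 2)} =
      {x : ℝ | ∃ k ∈ Finset.Icc (2 * m - ⌈P * m⌉ + 1) (2 * m + 1 - ⌊P * (m + 1)⌋),
        Q * x = (k : ℝ)} := by
    -- membership in the integer interval is the strict inequality `Q m < k < Q (m+1)`
    have key : ∀ k : ℤ, k ∈ Finset.Icc (2 * m - ⌈P * m⌉ + 1) (2 * m + 1 - ⌊P * (m + 1)⌋) ↔
        Q * m < k ∧ (k : ℝ) < Q * (m + 1) := by
      intro k
      have a1 : 2 * m - ⌈P * m⌉ + 1 ≤ k ↔ 2 * m - k < ⌈P * m⌉ := by omega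
      have a2 : k ≤ 2 * m + 1 - ⌊P * (m + 1)⌋ ↔ ⌊P * (m + 1)⌋ < 2 * m + 2 - k := by omega
      have hQ' : Q = 2 - P := by linarith
      rw [Finset.mem_Icc, a1, a2, Int.lt_ceil, Int.floor_lt, hQ']
      push_cast
      constructor
      · rintro ⟨h1, h2⟩; exact ⟨by linarith, by linarith⟩
      · rintro ⟨h1, h2⟩; exact ⟨by linarith, by linarith⟩
    ext x
    simp only [Set.mem_setOf_eq, Set.mem_Icc, key]
    constructor
    · rintro ⟨⟨h1, h2⟩, ⟨k, hk⟩, himp⟩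
      have hk' : Q * x = ((k - n : ℤ) : ℝ) := by push_cast; linarith
      refine ⟨k - n, ?_, hk'⟩
      rw [← hk']
      have hx1 : (m : ℝ) ≠ x := by
        rintro rfl
        have := himp ⟨2 * m + 2 * n - k, by
          push_cast; linear_combination (m : ℝ) * hPQ - hk⟩
        linarith
      have hx2 : x ≠ (m : ℝ) + 1 := by
        rintro rfl
        have := himp ⟨2 * (m + 1) + 2 * n - k, by
          push_cast; linear_combination ((m : ℝ) + 1) * hPQ - hk⟩
        linarith
      have h1' := lt_of_le_of_ne h1 hx1
      have h2' := lt_of_le_of_ne h2 hx2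
      exact ⟨by gcongr, by gcongr⟩
    · rintro ⟨k, ⟨h1, h2⟩, hk⟩
      rw [← hk] at h1 h2
      have h1' := lt_of_mul_lt_mul_left h1 hQ.le
      have h2' := lt_of_mul_lt_mul_left h2 hQ.le
      refine ⟨⟨h1'.le, h2'.le⟩, ⟨n + k, by push_cast; linarith⟩, ?_⟩
      rintro ⟨j, hj⟩
      have h2x : 2 * x = ((j - n + k : ℤ) : ℝ) := by
        push_cast; linear_combination hj + hk - x * hPQ
      have b1 : 2 * m < j - n + k := by
        have : ((2 * m : ℤ) : ℝ) < ((j - n + k : ℤ) : ℝ) := by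
          rw [← h2x]; push_cast; linarith
        exact_mod_cast this
      have b2 : j - n + k < 2 * m + 2 := by
        have : ((j - n + k : ℤ) : ℝ) < ((2 * m + 2 : ℤ) : ℝ) := by
          rw [← h2x]; push_cast; linarith
        exact_mod_cast this
      have b3 : j - n + k = 2 * m + 1 := by omega
      rw [b3] at h2x
      push_cast at h2x
      linarith
  rw [e1, e2, ncard_scaled P hP, ncard_scaled Q hQ, Int.card_Icc, Int.card_Icc]
  have c1 : ⌈P * m⌉ < ⌊P * (m + 1)⌋ + 2 := by
    have h1 := Int.ceil_lt_add_one (P * m)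
    have h2 := Int.lt_floor_add_one (P * (m + 1))
    have : (⌈P * m⌉ : ℝ) < ((⌊P * (m + 1)⌋ + 2 : ℤ) : ℝ) := by push_cast; linarith
    exact_mod_cast this
  have c2 : ⌊P * (m + 1)⌋ ≤ ⌈P * m⌉ + 1 := by
    have h1 := Int.le_ceil (P * m)
    have h2 := Int.floor_le (P * (m + 1))
    have : (⌊P * (m + 1)⌋ : ℝ) ≤ ((⌈P * m⌉ + 1 : ℤ) : ℝ) := by push_cast; linarith
    exact_mod_cast this
  omega

/-- Every unit segment contains exactly `2` intersection points.  Precisely: the vertical unit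
segment with lower endpoint `(m,n)` (taken half-open, so that each intersection point belongs
to exactly one of the segments it can lie on) contains exactly one intersection point of type
`P` and exactly one of type `Q`; and the horizontal unit segment from `(m,n)` to `(m+1,n)`
contains exactly two intersection points, where a point lying simultaneously on a `𝓟` line and
on a `𝓠` line (necessarily the midpoint `m + 1/2` of the segment) is counted twice. -/
theorem two_intersection_points (π : Param) :
    (∀ m n : ℤ,
      Set.ncard {y : ℝ | y ∈ Set.Ico (n : ℝ) ((n : ℝ) + 1) ∧ π.onP ((m : ℝ), y)} = 1 ∧
      Set.ncard {y : ℝ | y ∈ Set.Ico (n : ℝ) ((n : ℝ) + 1) ∧ π.onQ ((m : ℝ), y)} = 1) ∧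
    (∀ m n : ℤ,
      Set.ncard {x : ℝ | x ∈ Set.Icc (m : ℝ) ((m : ℝ) + 1) ∧ π.onP (x, (n : ℝ))} +
      Set.ncard {x : ℝ | x ∈ Set.Icc (m : ℝ) ((m : ℝ) + 1) ∧ π.onQ (x, (n : ℝ)) ∧
        (π.onP (x, (n : ℝ)) → x = (m : ℝ) + 1 / 2)} = 2) := by
  have hp : (0 : ℝ) < π.p := by exact_mod_cast π.p_pos
  have hpq : (π.p : ℝ) < π.q := by exact_mod_cast π.p_lt_q
  have hω : (π.ω : ℝ) = π.p + π.q := by simp [Param.ω]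
  have hω0 : (0 : ℝ) < π.ω := by rw [hω]; linarith
  have hP : 0 < π.P := by unfold Param.P; positivity
  have hQ : 0 < π.Q := by
    have : (0 : ℝ) < π.q := by linarith
    unfold Param.Q; positivity
  have hP1 : π.P ≤ 1 := by
    unfold Param.P
    rw [div_le_one hω0, hω]; linarith
  have hPQ : π.P + π.Q = 2 := by
    unfold Param.P Param.Q
    field_simp
    rw [hω]
  exact ⟨fun m n => ⟨ncard_vert (π.P * m) n, ncard_vert (π.Q * m) n⟩,
    fun m n => horiz_count π.P π.Q hP hP1 hQ hPQ m n⟩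
end
end

section
/- Let α ∈ (0, ω/2) be the unique integer with 2αp ≡ ±1 (mod ω). Then: (i) for each k = 0, 1, …, (ω−1)/2, the lines of 𝓗 of capacity 2k are exactly the lines y = c with c ≡ kα or c ≡ −kα (mod ω), and the lines of 𝓥 of capacity 2k are exactly the lines x = c with c ≡ kα or c ≡ −kα (mod ω); (ii) for each odd k with 1 ≤ k < ω, the lines of 𝓟 of mass k and the lines of 𝓠 of mass k are exactly those whose y-intercept c satisfies c ≡ kα or c ≡ −kα (mod ω). -/
noncomputable section
open scoped Classical

/-- Reading off the normalised value of `N / w`. -/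
theorem nrm_abs_iff (w N K : ℤ) (hw : 0 < w) (hK0 : 0 ≤ K) (hK : K < w) (x : ℝ)
    (hx : (w : ℝ) * x = N) :
    (w : ℝ) * |nrm x| = K ↔ (2 * w ∣ N - K ∨ 2 * w ∣ N + K) := by
  have hwR : (0 : ℝ) < w := by exact_mod_cast hw
  have key : (w : ℝ) * |nrm x| = ((|N - 2 * w * ⌊(x + 1) / 2⌋| : ℤ) : ℝ) := by
    unfold nrm
    rw [← abs_of_pos hwR, ← abs_mul]
    push_cast
    congr 1
    rw [← hx]
    ring
  rw [key]
  have h1 : N - 2 * w * ⌊(x + 1) / 2⌋ < w := by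
    have := Int.lt_floor_add_one ((x + 1) / 2)
    have h2 : (w : ℝ) * x < w * (2 * ⌊(x + 1) / 2⌋ + 1) :=
      mul_lt_mul_of_pos_left (by linarith) hwR
    rw [hx] at h2
    have h3 : N < w * (2 * ⌊(x + 1) / 2⌋ + 1) := by exact_mod_cast h2
    linarith
  have h2 : -w ≤ N - 2 * w * ⌊(x + 1) / 2⌋ := by
    have := Int.floor_le ((x + 1) / 2)
    have h2 : (w : ℝ) * (2 * ⌊(x + 1) / 2⌋ - 1) ≤ w * x :=
      mul_le_mul_of_nonneg_left (by linarith) hwR.le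
    rw [hx] at h2
    have h3 : w * (2 * ⌊(x + 1) / 2⌋ - 1) ≤ N := by exact_mod_cast h2
    linarith
  generalize ⌊(x + 1) / 2⌋ = m at h1 h2
  rw [Int.cast_inj]
  constructor
  · intro h
    rcases abs_choice (N - 2 * w * m) with h' | h'
    · left; exact ⟨m, by linarith⟩
    · right; exact ⟨m, by linarith⟩
  · have aux : ∀ t : ℤ, -(2 * w) < 2 * w * t → 2 * w * t < 2 * w → t = 0 := by
      intro t ha hb
      have : t < 1 := by nlinarith
      have : -1 < t := by nlinarith
      omega
    rintro (⟨t, ht⟩ | ⟨t, ht⟩)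
    · have h0 := aux (t - m) (by linarith) (by linarith)
      have : t = m := by omega
      subst this
      rw [show N - 2 * w * t = K by linarith, abs_of_nonneg hK0]
    · rcases eq_or_lt_of_le h2 with h3 | h3
      · have h0 := aux (t - m) (by linarith) (by linarith)
        have : t = m := by omega
        subst this
        rw [show N - 2 * w * t = -K by linarith, abs_neg, abs_of_nonneg hK0]
      · have h0 := aux (t - m) (by linarith) (by linarith)
        have : t = m := by omega
        subst this
        rw [show N - 2 * w * t = -K by linarith, abs_neg, abs_of_nonneg hK0]

theorem anchor_arith (w p a k c : ℤ)
    (h : 2 * a * p ≡ 1 [ZMOD w] ∨ 2 * a * p ≡ -1 [ZMOD w]) :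
    (w ∣ 2 * p * c - k ∨ w ∣ 2 * p * c + k) ↔
      (c ≡ k * a [ZMOD w] ∨ c ≡ -(k * a) [ZMOD w]) := by
  rw [Int.modEq_comm, Int.modEq_iff_dvd, Int.modEq_comm (b := -1), Int.modEq_iff_dvd] at h
  rw [Int.modEq_comm, Int.modEq_iff_dvd, Int.modEq_comm (b := -(k * a)), Int.modEq_iff_dvd]
  rcases h with ⟨t, ht⟩ | ⟨t, ht⟩
  · constructor
    · rintro (⟨s, hs⟩ | ⟨s, hs⟩)
      · left; exact ⟨a * s - t * c, by linear_combination a * hs - c * ht⟩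
      · right; exact ⟨a * s - t * c, by linear_combination a * hs - c * ht⟩
    · rintro (⟨s, hs⟩ | ⟨s, hs⟩)
      · left; exact ⟨2 * p * s + k * t, by linear_combination 2 * p * hs + k * ht⟩
      · right; exact ⟨2 * p * s - k * t, by linear_combination 2 * p * hs - k * ht⟩
  · constructor
    · rintro (⟨s, hs⟩ | ⟨s, hs⟩)
      · right; exact ⟨t * c - a * s, by linear_combination c * ht - a * hs⟩
      · left; exact ⟨t * c - a * s, by linear_combination c * ht - a * hs⟩
    · rintro (⟨s, hs⟩ | ⟨s, hs⟩)
      · right; exact ⟨2 * p * s + k * t, by linear_combination 2 * p * hs + k * ht⟩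
      · left; exact ⟨2 * p * s - k * t, by linear_combination 2 * p * hs - k * ht⟩

theorem Param.omega_odd (π : Param) : Odd π.ω := by
  have h1 := π.even_pq
  have h2 := π.coprime
  unfold Param.ω
  rw [← Nat.not_even_iff_odd]
  intro h
  rw [Nat.even_add] at h
  rw [Nat.even_mul] at h1
  have hp : Even π.p := by tauto
  have hq : Even π.q := by tauto
  have := Nat.dvd_gcd hp.two_dvd hq.two_dvd
  rw [h2] at this
  omega

theorem two_mul_dvd_iff_of_even (w n : ℤ) (hw : Odd w) (hn : Even n) : 2 * w ∣ n ↔ w ∣ n := by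
  constructor
  · exact fun h => (Dvd.intro_left 2 rfl).trans h
  · intro h
    have hc : IsCoprime (2 : ℤ) w := by
      obtain ⟨r, hr⟩ := hw
      exact ⟨-r, 1, by rw [hr]; ring⟩
    exact hc.mul_dvd hn.two_dvd h

/-- The anchoring lemma (the tune controls the geometry).  Let `α ∈ (0, ω/2)` be the integer
with `2αp ≡ ±1 (mod ω)`.  Then: (i) for each `k = 0, …, (ω-1)/2`, the horizontal lines of `𝓗`
(and likewise the vertical lines of `𝓥`, the capacity being given by the same formula) of
capacity `2k` are exactly those `y = c` (resp. `x = c`) with `c ≡ kα` or `c ≡ -kα (mod ω)`;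
(ii) for each odd `k` with `1 ≤ k < ω`, the `𝓟` lines (and likewise the `𝓠` lines, the mass
being given by the same formula) of mass `k` are exactly those with `y`-intercept `c` with
`c ≡ kα` or `c ≡ -kα (mod ω)`. -/
theorem anchor (π : Param) (α : ℕ) (hα₀ : 0 < α) (hα₁ : 2 * α < π.ω)
    (hα : (2 * α * π.p : ℤ) ≡ 1 [ZMOD (π.ω : ℤ)] ∨ (2 * α * π.p : ℤ) ≡ -1 [ZMOD (π.ω : ℤ)]) :
    (∀ k : ℕ, k ≤ (π.ω - 1) / 2 → ∀ c : ℤ,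
      (π.cap c = 2 * k ↔
        ((c : ℤ) ≡ (k * α : ℤ) [ZMOD (π.ω : ℤ)] ∨ (c : ℤ) ≡ -(k * α : ℤ) [ZMOD (π.ω : ℤ)]))) ∧
    (∀ k : ℕ, Odd k → 1 ≤ k → k < π.ω → ∀ c : ℤ,
      (π.mass c = k ↔
        ((c : ℤ) ≡ (k * α : ℤ) [ZMOD (π.ω : ℤ)] ∨ (c : ℤ) ≡ -(k * α : ℤ) [ZMOD (π.ω : ℤ)]))) := by
  have hodd := π.omega_odd
  have hoddZ : Odd (π.ω : ℤ) := by exact_mod_cast hodd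
  have hpos : 0 < π.ω := by omega
  have hR : (π.ω : ℝ) ≠ 0 := by exact_mod_cast hpos.ne'
  refine ⟨fun k hk c => ?_, fun k hko hk1 hk c => ?_⟩
  · rw [← anchor_arith _ _ _ _ _ hα]
    have h := nrm_abs_iff (π.ω : ℤ) (4 * π.p * c) (2 * k) (by omega) (by omega) (by omega)
      (2 * π.P * c) (by unfold Param.P; push_cast; field_simp; ring)
    unfold Param.cap
    push_cast at h
    rw [h, show (4 * π.p * c - 2 * k : ℤ) = 2 * (2 * π.p * c - k) by ring,
      show (4 * π.p * c + 2 * k : ℤ) = 2 * (2 * π.p * c + k) by ring,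
      mul_dvd_mul_iff_left two_ne_zero, mul_dvd_mul_iff_left two_ne_zero]
  · rw [← anchor_arith _ _ _ _ _ hα]
    have h := nrm_abs_iff (π.ω : ℤ) (2 * π.p * c + π.ω) k (by omega) (by omega) (by omega)
      (π.P * c + 1) (by unfold Param.P; push_cast; field_simp)
    unfold Param.mass
    push_cast at h
    have hkZ : Odd (k : ℤ) := by exact_mod_cast hko
    have he : Even (2 * π.p * c : ℤ) := ⟨π.p * c, by ring⟩
    rw [h, two_mul_dvd_iff_of_even _ _ hoddZ ((he.add_odd hoddZ).sub_odd hkZ),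
      two_mul_dvd_iff_of_even _ _ hoddZ ((he.add_odd hoddZ).add_odd hkZ),
      show (2 * π.p * c + π.ω - k : ℤ) = (2 * π.p * c - k) + π.ω by ring,
      show (2 * π.p * c + π.ω + k : ℤ) = (2 * π.p * c + k) + π.ω by ring,
      dvd_add_self_right, dvd_add_self_right]
end
end

section
/- The reflection (x,y) ↦ (x,−y) maps the set of light points of the plaid model bijectively to itself. Moreover, it preserves the type (P or Q) of light points lying on horizontal (𝓗) lines, and it interchanges the types of light points lying on vertical (𝓥) lines: a light point of type P on a vertical line is sent to a light point of type Q, and vice versa. -/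
noncomputable section
open scoped Classical

theorem nrm_eq_of (x y : ℝ) (k : ℤ) (h : x = y + 2 * k) (h1 : -1 ≤ y) (h2 : y < 1) :
    nrm x = y := by
  have : ⌊(x + 1) / 2⌋ = k := by
    rw [Int.floor_eq_iff]; constructor <;> linarith
  unfold nrm; rw [this]; linarith

theorem nrm_spec (x : ℝ) : ∃ k : ℤ, x = nrm x + 2 * k ∧ -1 ≤ nrm x ∧ nrm x < 1 := by
  refine ⟨⌊(x + 1) / 2⌋, ?_, ?_, ?_⟩ <;> unfold nrm
  · ring
  · linarith [Int.floor_le ((x + 1) / 2)]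
  · linarith [Int.lt_floor_add_one ((x + 1) / 2)]

theorem lightPair_iff (a b : ℝ) : lightPair a b ↔ (0 < b ∧ b < a) ∨ (a < b ∧ b < 0) := by
  unfold lightPair
  constructor
  · rintro ⟨h, h'⟩
    rcases pos_and_pos_or_neg_and_neg_of_mul_pos h with ⟨ha, hb⟩ | ⟨ha, hb⟩
    · rw [abs_of_pos ha, abs_of_pos hb] at h'; exact Or.inl ⟨hb, h'⟩
    · rw [abs_of_neg ha, abs_of_neg hb] at h'; exact Or.inr ⟨by linarith, hb⟩
  · rintro (⟨h, h'⟩ | ⟨h, h'⟩)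
    · have ha : 0 < a := h.trans h'
      rw [abs_of_pos ha, abs_of_pos h]; exact ⟨mul_pos ha h, h'⟩
    · have ha : a < 0 := h.trans h'
      rw [abs_of_neg ha, abs_of_neg h']; exact ⟨mul_pos_of_neg_of_neg ha h', by linarith⟩

theorem light_H_aux (A B A' B' : ℝ) (hA : nrm A ≠ -1) (hA' : A' = -A) (hB' : B' = B - A)
    (h : lightPair (nrm A) (nrm B)) : lightPair (nrm A') (nrm B') := by
  obtain ⟨k, hk, hk1, hk2⟩ := nrm_spec A
  obtain ⟨l, hl, hl1, hl2⟩ := nrm_spec B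
  have hk1' : -1 < nrm A := lt_of_le_of_ne hk1 (Ne.symm hA)
  rw [lightPair_iff] at h ⊢
  have e1 : nrm A' = -nrm A :=
    nrm_eq_of _ _ (-k) (by push_cast; linarith) (by linarith) (by linarith)
  have e2 : nrm B' = nrm B - nrm A := by
    refine nrm_eq_of _ _ (l - k) (by push_cast; linarith) ?_ ?_ <;>
      rcases h with h | h <;> linarith [h.1, h.2]
  rw [e1, e2]
  rcases h with h | h
  · right; constructor <;> linarith [h.1, h.2]
  · left; constructor <;> linarith [h.1, h.2]

theorem light_V_aux (A B B' : ℝ) (hB' : B' = A - B + 2)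
    (h : lightPair (nrm A) (nrm B)) : lightPair (nrm A) (nrm B') := by
  obtain ⟨k, hk, hk1, hk2⟩ := nrm_spec A
  obtain ⟨l, hl, hl1, hl2⟩ := nrm_spec B
  rw [lightPair_iff] at h ⊢
  have e2 : nrm B' = nrm A - nrm B := by
    refine nrm_eq_of _ _ (k - l + 1) (by push_cast; linarith) ?_ ?_ <;>
      rcases h with h | h <;> linarith [h.1, h.2]
  rw [e2]
  rcases h with h | h
  · left; constructor <;> linarith [h.1, h.2]
  · right; constructor <;> linarith [h.1, h.2]

namespace Param

theorem omega_pos (π : Param) : (0 : ℝ) < π.ω := by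
  have := π.p_pos
  unfold ω; exact_mod_cast (by omega)

theorem omega_odd_s6 (π : Param) : Odd π.ω := by
  rcases Nat.even_or_odd π.p with hp | hp <;> rcases Nat.even_or_odd π.q with hq | hq
  · exfalso
    have := Nat.dvd_gcd hp.two_dvd hq.two_dvd
    rw [π.coprime] at this
    omega
  · exact hp.add_odd hq
  · exact hp.add_even hq
  · exact absurd π.even_pq (by rw [Nat.not_even_iff_odd]; exact hp.mul hq)

theorem P_add_Q (π : Param) : π.P + π.Q = 2 := by
  have h := π.omega_pos
  have h' : (π.ω : ℝ) = π.p + π.q := by unfold ω; push_cast; ring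
  unfold P Q
  rw [← add_div, div_eq_iff h.ne', h']; ring

theorem FH_ne (π : Param) (n : ℤ) : nrm (2 * π.P * n) ≠ -1 := by
  intro h
  obtain ⟨k, hk, -, -⟩ := nrm_spec (2 * π.P * n)
  rw [h] at hk
  have hw := π.omega_pos
  have e : (4 * π.p * n : ℝ) = (-1 + 2 * k) * π.ω := by
    rw [← hk]; unfold P; field_simp; ring
  have e' : (4 * π.p * n : ℤ) = (-1 + 2 * k) * π.ω := by exact_mod_cast e
  have ho : Odd ((-1 + 2 * k) * (π.ω : ℤ)) :=
    Odd.mul ⟨k - 1, by ring⟩ (by exact_mod_cast π.omega_odd_s6)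
  rw [← e', ← Int.not_even_iff_odd] at ho
  exact ho ⟨2 * π.p * n, by ring⟩

theorem HP_aux (π : Param) (x y : ℝ) (h : π.lightHP (x, y)) : π.lightHP (x, -y) := by
  obtain ⟨⟨n, hn⟩, ⟨k, hk⟩, hl⟩ := h
  simp only at hn hk
  refine ⟨⟨-n, by simp [hn]⟩, ⟨k - 2 * n, by push_cast; linarith⟩, ?_⟩
  refine light_H_aux _ _ _ _ ?_ ?_ ?_ hl
  · simp only [hn]; exact π.FH_ne n
  · simp only; ring
  · simp only; ring

theorem HQ_aux (π : Param) (x y : ℝ) (h : π.lightHQ (x, y)) : π.lightHQ (x, -y) := by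
  obtain ⟨⟨n, hn⟩, ⟨k, hk⟩, hl⟩ := h
  simp only at hn hk
  refine ⟨⟨-n, by simp [hn]⟩, ⟨k - 2 * n, by push_cast; linarith⟩, ?_⟩
  refine light_H_aux _ _ _ _ ?_ ?_ ?_ hl
  · simp only [hn]; exact π.FH_ne n
  · simp only; ring
  · simp only; ring

theorem VP_aux (π : Param) (x y : ℝ) (h : π.lightVP (x, y)) : π.lightVQ (x, -y) := by
  obtain ⟨⟨n, hn⟩, ⟨k, hk⟩, hl⟩ := h
  simp only at hn hk
  have hQ : π.Q = 2 - π.P := by linarith [π.P_add_Q]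
  refine ⟨⟨n, hn⟩, ⟨2 * n - k, ?_⟩, ?_⟩
  · push_cast; rw [← hk, ← hn, hQ]; ring
  · refine light_V_aux _ _ _ ?_ hl
    simp only [hQ]; ring

theorem VQ_aux (π : Param) (x y : ℝ) (h : π.lightVQ (x, y)) : π.lightVP (x, -y) := by
  obtain ⟨⟨n, hn⟩, ⟨k, hk⟩, hl⟩ := h
  simp only at hn hk
  have hQ : π.Q = 2 - π.P := by linarith [π.P_add_Q]
  refine ⟨⟨n, hn⟩, ⟨2 * n - k, ?_⟩, ?_⟩
  · push_cast; rw [← hk, ← hn, hQ]; ring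
  · refine light_V_aux _ _ _ ?_ hl
    simp only [hQ]; ring

end Param

/-- Reflection in the `x`-axis, `(x,y) ↦ (x,-y)`, maps the set of light points of the plaid
model bijectively to itself.  It preserves the type (`P` or `Q`) of light points lying on
horizontal (`𝓗`) lines, and it interchanges the types of light points lying on vertical (`𝓥`)
lines. -/
theorem reflection_symmetry (π : Param) (z : ℝ × ℝ) :
    (π.light (z.1, -z.2) ↔ π.light z) ∧
    (π.lightHP (z.1, -z.2) ↔ π.lightHP z) ∧
    (π.lightHQ (z.1, -z.2) ↔ π.lightHQ z) ∧
    (π.lightVQ (z.1, -z.2) ↔ π.lightVP z) ∧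
    (π.lightVP (z.1, -z.2) ↔ π.lightVQ z) := by
  obtain ⟨x, y⟩ := z
  have h1 : π.lightHP (x, -y) ↔ π.lightHP (x, y) :=
    ⟨fun h => by simpa using π.HP_aux _ _ h, π.HP_aux x y⟩
  have h2 : π.lightHQ (x, -y) ↔ π.lightHQ (x, y) :=
    ⟨fun h => by simpa using π.HQ_aux _ _ h, π.HQ_aux x y⟩
  have h3 : π.lightVQ (x, -y) ↔ π.lightVP (x, y) :=
    ⟨fun h => by simpa using π.VQ_aux _ _ h, π.VP_aux x y⟩
  have h4 : π.lightVP (x, -y) ↔ π.lightVQ (x, y) :=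
    ⟨fun h => by simpa using π.VP_aux _ _ h, π.VQ_aux x y⟩
  refine ⟨?_, h1, h2, h3, h4⟩
  simp only [Param.light, h1, h2, h3, h4]
  tauto
end
end
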